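/- arXiv:2605.09569 — 2 statements merged into one kernel-verified Lean document; each statement's English description precedes it below -/
import Mathlib

section
/- For every η ∈ (0,1) there exists a constant c > 0 depending only on η such that the following holds: for all positive integers d₁, d₂, all integers 1 ≤ s₁ ≤ d₁ and 1 ≤ s₂ ≤ d₂, and every real μ > 0 with μ² < c·R(s₁,s₂,d₁,d₂), every test Δ satisfies R(Δ,μ) ≥ η; consequently the minimax separation rate satisfies (μ*)² ≥ c·R(s₁,s₂,d₁,d₂). -/
open MeasureTheory ProbabilityTheory

noncomputable def Pmeas (d₁ d₂ : ℕ) (X : Fin d₁ → Fin d₂ → ℝ) :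
    Measure (Fin d₁ → Fin d₂ → ℝ) :=
  Measure.pi fun i => Measure.pi fun j => gaussianReal (X i j) 1

def Theta (d₁ d₂ s₁ s₂ : ℕ) (μ : ℝ) : Set (Fin d₁ → Fin d₂ → ℝ) :=
  {X | ∃ (S₁ : Finset (Fin d₁)) (S₂ : Finset (Fin d₂)),
    S₁.card = s₁ ∧ S₂.card = s₂ ∧
    (∀ i j, i ∈ S₁ → j ∈ S₂ → μ ≤ X i j) ∧
    (∀ i j, ¬(i ∈ S₁ ∧ j ∈ S₂) → X i j = 0)}

noncomputable def risk (d₁ d₂ s₁ s₂ : ℕ) (μ : ℝ)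
    (Δ : (Fin d₁ → Fin d₂ → ℝ) → Bool) : ℝ :=
  (Pmeas d₁ d₂ 0 {y | Δ y = true}).toReal +
    ⨆ X ∈ Theta d₁ d₂ s₁ s₂ μ, (Pmeas d₁ d₂ X {y | Δ y = false}).toReal

noncomputable def muStar (η : ℝ) (d₁ d₂ s₁ s₂ : ℕ) : ℝ :=
  sInf {μ : ℝ | 0 < μ ∧ ∃ Δ : (Fin d₁ → Fin d₂ → ℝ) → Bool,
    Measurable Δ ∧ risk d₁ d₂ s₁ s₂ μ Δ < η}

/-- ψ(s₁,s₂,d₁,d₂) = (1/s₁)·log(1 + (d₂/s₂²)·log(e·C(d₁,s₁))) -/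
noncomputable def psi (s₁ s₂ d₁ d₂ : ℕ) : ℝ :=
  (1 / (s₁ : ℝ)) *
    Real.log (1 + ((d₂ : ℝ) / (s₂ : ℝ) ^ 2) *
      Real.log (Real.exp 1 * (d₁.choose s₁ : ℝ)))

/-- φ(s₁,s₂,d₁,d₂) = (d₁/s₁²)·log(1 + d₂/s₂²) -/
noncomputable def phi (s₁ s₂ d₁ d₂ : ℕ) : ℝ :=
  ((d₁ : ℝ) / (s₁ : ℝ) ^ 2) * Real.log (1 + (d₂ : ℝ) / (s₂ : ℝ) ^ 2)

/-- R(s₁,s₂,d₁,d₂) = min(ψ₁₂ + ψ₂₁, φ₁₂, φ₂₁) -/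
noncomputable def rateR (s₁ s₂ d₁ d₂ : ℕ) : ℝ :=
  min (psi s₁ s₂ d₁ d₂ + psi s₂ s₁ d₂ d₁) (min (phi s₁ s₂ d₁ d₂) (phi s₂ s₁ d₂ d₁))

section Overlap

open Finset

lemma choose_sub_le_choose_mul_div_pow {d s : ℕ} (hsd : s ≤ d) :
    ∀ j ≤ s, ((d - j).choose (s - j) : ℝ) ≤ d.choose s * ((s : ℝ) / d) ^ j := by
  intro j
  induction j with
  | zero => simp
  | succ j ih =>
    intro hj
    have h := ih (by omega)
    obtain ⟨k, hk⟩ : ∃ k, s - j = k + 1 := ⟨s - j - 1, by omega⟩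
    obtain ⟨n, hn⟩ : ∃ n, d - j = n + 1 := ⟨d - j - 1, by omega⟩
    rw [hk, hn] at h
    rw [show s - (j + 1) = k by omega, show d - (j + 1) = n by omega]
    have e : ((n : ℝ) + 1) * n.choose k = (n + 1).choose (k + 1) * (k + 1) := by
      exact_mod_cast Nat.add_one_mul_choose_eq n k
    have hd : (0 : ℝ) < d := by
      have : 0 < d := by omega
      exact_mod_cast this
    have hs' : (s : ℝ) = k + 1 + j := by
      have : s = k + 1 + j := by omega
      exact_mod_cast this
    have hd' : (d : ℝ) = n + 1 + j := by
      have : d = n + 1 + j := by omega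
      exact_mod_cast this
    have hkn : (k : ℝ) ≤ n := by
      have : k ≤ n := by omega
      exact_mod_cast this
    have hr : ((k : ℝ) + 1) / (n + 1) ≤ s / d := by
      rw [div_le_div_iff₀ (by positivity) hd, hs', hd']
      nlinarith [(Nat.cast_nonneg j : (0 : ℝ) ≤ j)]
    have e' : (n.choose k : ℝ) = (n + 1).choose (k + 1) * ((k + 1) / (n + 1)) := by
      field_simp
      linarith
    rw [e', pow_succ, ← mul_assoc]
    gcongr

variable {α : Type*} [Fintype α] [DecidableEq α]

lemma card_filter_superset_le {s : ℕ} (hs : s ≤ Fintype.card α) (J : Finset α) :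
    (#{T ∈ powersetCard s (univ : Finset α) | J ⊆ T} : ℝ) ≤
      (Fintype.card α).choose s * ((s : ℝ) / Fintype.card α) ^ #J := by
  by_cases hJ : #J ≤ s
  · rw [card_filter_powersetCard_subset _ _ _ (subset_univ J) hJ, card_univ]
    exact choose_sub_le_choose_mul_div_pow hs _ hJ
  · rw [filter_false_of_mem]
    · simp only [card_empty, Nat.cast_zero]
      positivity
    · intro T hT hJT
      rw [mem_powersetCard] at hT
      have := card_le_card hJT
      omega

lemma sum_pow_card_inter_le {s : ℕ} (hs : s ≤ Fintype.card α) {S : Finset α} (hS : #S = s)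
    {x : ℝ} (hx : 0 ≤ x) :
    ∑ T ∈ powersetCard s (univ : Finset α), (1 + x) ^ #(S ∩ T) ≤
      (Fintype.card α).choose s * Real.exp (x * ((s : ℝ) ^ 2 / Fintype.card α)) := by
  have h1 : ∀ T : Finset α, (1 + x) ^ #(S ∩ T) =
      ∑ J ∈ S.powerset, if J ⊆ T then x ^ #J else 0 := by
    intro T
    rw [← sum_filter, add_comm, ← sum_pow_mul_eq_add_pow]
    simp only [one_pow, mul_one]
    refine sum_congr ?_ fun _ _ ↦ rfl
    ext J
    rw [mem_filter, mem_powerset, mem_powerset, subset_inter_iff]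
  have h2 : ∀ J : Finset α, ∑ T ∈ powersetCard s (univ : Finset α),
      (if J ⊆ T then x ^ #J else 0) ≤
      (Fintype.card α).choose s * ((x * ((s : ℝ) / Fintype.card α)) ^ #J * 1 ^ (#S - #J)) := by
    intro J
    rw [← sum_filter, sum_const, nsmul_eq_mul, mul_pow, one_pow, mul_one]
    have := mul_le_mul_of_nonneg_right (card_filter_superset_le hs J) (pow_nonneg hx #J)
    linarith
  simp_rw [h1]
  rw [sum_comm]
  refine (sum_le_sum fun J _ ↦ h2 J).trans ?_
  rw [← mul_sum, sum_pow_mul_eq_add_pow, hS]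
  gcongr
  have h3 : x * ((s : ℝ) / Fintype.card α) + 1 ≤ Real.exp (x * ((s : ℝ) / Fintype.card α)) :=
    Real.add_one_le_exp _
  refine (pow_le_pow_left₀ (by positivity) h3 s).trans_eq ?_
  rw [← Real.exp_nat_mul]
  congr 1
  ring

lemma pow_div_factorial_le_exp_one_pow (k : ℕ) :
    (k : ℝ) ^ k / k.factorial ≤ Real.exp 1 ^ k := by
  rw [← Real.exp_nat_mul, mul_one]
  exact Real.pow_div_factorial_le_exp k (by positivity) k

lemma choose_le_exp_mul_div_pow {n k : ℕ} (hk : 1 ≤ k) :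
    (n.choose k : ℝ) ≤ (Real.exp 1 * (n / k)) ^ k := by
  have h := pow_div_factorial_le_exp_one_pow k
  have hk' : (0 : ℝ) < k := by exact_mod_cast hk
  calc (n.choose k : ℝ) ≤ (n : ℝ) ^ k / k.factorial := Nat.choose_le_pow_div k n
    _ = (k : ℝ) ^ k / k.factorial * (n / k) ^ k := by
        rw [div_pow]; field_simp
    _ ≤ Real.exp 1 ^ k * (n / k) ^ k := by gcongr
    _ = _ := by rw [mul_pow]

lemma card_filter_card_inter_eq_le {s : ℕ} (hs : s ≤ Fintype.card α) {S : Finset α}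
    (hS : #S = s) {k : ℕ} (hk : 1 ≤ k) :
    (#{T ∈ powersetCard s (univ : Finset α) | #(S ∩ T) = k} : ℝ) ≤
      (Fintype.card α).choose s *
        (Real.exp 1 / (k * ((Fintype.card α : ℝ) / (s : ℝ) ^ 2))) ^ k := by
  have hsub : {T ∈ powersetCard s (univ : Finset α) | #(S ∩ T) = k} ⊆
      (powersetCard k S).biUnion fun J ↦ {T ∈ powersetCard s (univ : Finset α) | J ⊆ T} := by
    intro T hT
    simp only [mem_filter, mem_biUnion] at hT ⊢
    exact ⟨S ∩ T, mem_powersetCard.2 ⟨inter_subset_left, hT.2⟩, hT.1, inter_subset_right⟩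
  calc (#{T ∈ powersetCard s (univ : Finset α) | #(S ∩ T) = k} : ℝ)
      ≤ ∑ J ∈ powersetCard k S, (#{T ∈ powersetCard s (univ : Finset α) | J ⊆ T} : ℝ) := by
        exact_mod_cast (card_le_card hsub).trans card_biUnion_le
    _ ≤ ∑ J ∈ powersetCard k S,
          ((Fintype.card α).choose s * ((s : ℝ) / Fintype.card α) ^ k : ℝ) := by
        refine sum_le_sum fun J hJ ↦ ?_
        rw [← (mem_powersetCard.1 hJ).2]
        exact card_filter_superset_le hs J
    _ = s.choose k * ((Fintype.card α).choose s * ((s : ℝ) / Fintype.card α) ^ k) := by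
        rw [sum_const, card_powersetCard, hS, nsmul_eq_mul]
    _ ≤ (Real.exp 1 * (s / k)) ^ k *
          ((Fintype.card α).choose s * ((s : ℝ) / Fintype.card α) ^ k) := by
        gcongr
        exact choose_le_exp_mul_div_pow hk
    _ = _ := by
        rw [mul_left_comm, ← mul_pow]
        congr 2
        have hk' : (k : ℝ) ≠ 0 := by positivity
        rw [div_eq_mul_inv (Real.exp 1), mul_inv, inv_div]
        ring

end Overlap

section ExpBounds

open Real

lemma exp_sub_one_le_eight_mul {x : ℝ} (h0 : 0 ≤ x) (h2 : x ≤ 2) : exp x - 1 ≤ 8 * x := by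
  have h1 : 1 - x ≤ exp (-x) := by linarith [add_one_le_exp (-x)]
  have h3 : exp x - 1 ≤ x * exp x := by
    have := mul_le_mul_of_nonneg_right h1 (exp_pos x).le
    rw [← exp_add, neg_add_cancel, exp_zero] at this
    linarith
  have h4 : exp x ≤ 8 := by
    have h : exp x ≤ exp 2 := exp_le_exp.2 h2
    have h' : exp 2 = exp 1 * exp 1 := by rw [← exp_add]; norm_num
    nlinarith [exp_one_lt_d9, exp_pos 1]
  nlinarith

lemma exp_sub_one_le_two_mul {x : ℝ} (h0 : 0 ≤ x) (h1 : x ≤ 1) : exp x - 1 ≤ 2 * x := by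
  have := abs_exp_sub_one_le (x := x) (by rwa [abs_of_nonneg h0])
  rw [abs_of_nonneg h0] at this
  exact (le_abs_self _).trans this

lemma exp_mul_log_one_add_le {t a : ℝ} (ha : 0 ≤ a) (ht0 : 0 ≤ t) (ht1 : t ≤ 1) :
    exp (t * log (1 + a)) ≤ 1 + t * a := by
  rw [mul_comm t, ← rpow_def_of_pos (by linarith)]
  exact rpow_one_add_le_one_add_mul_self (by linarith) ht0 ht1

/-- The overlap bound away from the bulk, by comparison with the value at full overlap. -/
lemma exp_mul_le_of_two_le {lam c a b L s k : ℝ} (hc0 : 0 < c) (hc : c ≤ 1 / 32)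
    (ha : 0 < a) (hk : 1 ≤ k) (hks : k ≤ s)
    (hL : 1 ≤ L) (hL' : L ≤ 1 + s * (1 + log (s * b)))
    (h3 : lam * s ≤ 2 * c * log (1 + a * L)) (hlk : 2 ≤ lam * k) (hkb : 32 ≤ k * b) :
    exp (lam * k) - 1 ≤ a * (12 * c * (k * log (k * b))) := by
  have hk0 : 0 < k := by linarith
  have hlam : 0 < lam := by
    by_contra h
    nlinarith
  have hb : 0 < b := by
    by_contra h
    nlinarith
  set t := s / k with ht
  have ht1 : 1 ≤ t := by rw [ht, le_div_iff₀ hk0]; linarith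
  have hst : s = k * t := by rw [ht]; field_simp
  have hlogkb : 1 ≤ log (k * b) := by
    rw [le_log_iff_exp_le (by linarith)]
    linarith [exp_one_lt_d9]
  have hlogt0 : 0 ≤ log t := log_nonneg ht1
  have hlogt : log t ≤ t - 1 := log_le_sub_one_of_pos (by linarith)
  have hsb : log (s * b) = log t + log (k * b) := by
    rw [hst, show k * t * b = t * (k * b) by ring, log_mul (by positivity) (by positivity)]
  have hs1 : 1 ≤ s := hk.trans hks
  have hL3 : L ≤ 3 * (k * log (k * b)) * t ^ 2 := by
    have h1 : 1 ≤ log (s * b) := by rw [hsb]; linarith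
    have h2 : L ≤ 3 * (s * log (s * b)) := by nlinarith
    have h4 : log (s * b) ≤ log (k * b) * t := by rw [hsb]; nlinarith
    calc L ≤ 3 * (s * log (s * b)) := h2
      _ ≤ 3 * (s * (log (k * b) * t)) := by gcongr
      _ = _ := by rw [hst]; ring
  have hfull : exp (lam * s) ≤ 1 + 2 * c * (a * L) :=
    (exp_le_exp.2 h3).trans (exp_mul_log_one_add_le (by positivity) (by positivity) (by linarith))
  have hfull2 : exp (lam * s) ≤ 4 * c * (a * L) := by
    have : 2 ≤ exp (lam * s) := by
      have h5 : lam * k ≤ lam * s := by gcongr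
      linarith [add_one_le_exp (lam * s)]
    linarith
  have ht2 : t ^ 2 ≤ exp (lam * s - lam * k) := by
    have h6 : t ≤ exp (t - 1) := by linarith [add_one_le_exp (t - 1)]
    calc t ^ 2 ≤ exp (t - 1) ^ 2 := by gcongr
      _ = exp (2 * (t - 1)) := by rw [← exp_nat_mul]; norm_num
      _ ≤ _ := by
        rw [exp_le_exp, hst]
        nlinarith
  have hmul : exp (lam * k) * t ^ 2 ≤ exp (lam * s) := by
    calc exp (lam * k) * t ^ 2 ≤ exp (lam * k) * exp (lam * s - lam * k) := by gcongr
      _ = _ := by rw [← exp_add]; congr 1; ring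
  have hfin : exp (lam * k) * t ^ 2 ≤ a * (12 * c * (k * log (k * b))) * t ^ 2 := by
    calc _ ≤ 4 * c * (a * L) := hmul.trans hfull2
      _ ≤ 4 * c * (a * (3 * (k * log (k * b)) * t ^ 2)) := by gcongr
      _ = _ := by ring
  have := le_of_mul_le_mul_right hfin (by positivity)
  linarith

lemma exp_div_le {lam c a b L s : ℝ} {k : ℕ} (hc0 : 0 < c) (hc : c ≤ 1 / 32)
    (hlam : 0 ≤ lam) (ha : 0 < a) (hb : 0 < b) (hks : (k : ℝ) ≤ s)
    (hL : 1 ≤ L) (hL' : L ≤ 1 + s * (1 + log (s * b)))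
    (h1 : lam ≤ c * (a * log (1 + b))) (h2 : lam ≤ c * (b * log (1 + a)))
    (h3 : lam * s ≤ 2 * c * log (1 + a * L)) :
    exp ((exp (lam * k) - 1) / a) ≤ exp (8 * c * log (1 + b)) ^ k + (exp (32 * c) - 1) +
      if 1 ≤ k ∧ 32 ≤ k * b then 24 * c * √(k * b) ^ k else 0 := by
  have hb' : 0 ≤ log (1 + b) := log_nonneg (by linarith)
  have ha' : 0 ≤ log (1 + a) := log_nonneg (by linarith)
  have e1 : (1 : ℝ) ≤ exp (8 * c * log (1 + b)) ^ k :=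
    one_le_pow₀ (one_le_exp (by positivity))
  have e2 : (0 : ℝ) ≤ exp (32 * c) - 1 := by linarith [add_one_le_exp (32 * c)]
  have e3 : (0 : ℝ) ≤ if 1 ≤ k ∧ 32 ≤ k * b then 24 * c * √(k * b) ^ k else 0 := by
    split_ifs <;> positivity
  by_cases hlk : lam * k ≤ 2
  · have : exp ((exp (lam * k) - 1) / a) ≤ exp (8 * c * log (1 + b)) ^ k := by
      rw [← exp_nat_mul, exp_le_exp, div_le_iff₀ ha]
      calc exp (lam * k) - 1 ≤ 8 * (lam * k) := exp_sub_one_le_eight_mul (by positivity) hlk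
        _ ≤ 8 * (c * (a * log (1 + b)) * k) := by gcongr
        _ = _ := by ring
    linarith
  by_cases hkb : k * b ≤ 32
  · have : exp ((exp (lam * k) - 1) / a) ≤ exp (32 * c) := by
      rw [exp_le_exp, div_le_iff₀ ha]
      have h4 : lam * k ≤ 32 * c * log (1 + a) := by
        calc lam * k ≤ c * (b * log (1 + a)) * k := by gcongr
          _ = c * (k * b) * log (1 + a) := by ring
          _ ≤ c * 32 * log (1 + a) := by gcongr
          _ = _ := by ring
      have := (exp_le_exp.2 h4).trans
        (exp_mul_log_one_add_le ha.le (by positivity) (by linarith))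
      linarith
    linarith
  · push Not at hlk hkb
    have hk1 : 1 ≤ k := by
      by_contra h
      have : k = 0 := by omega
      subst this
      norm_num at hkb
    have hk1' : (1 : ℝ) ≤ k := by exact_mod_cast hk1
    rw [if_pos ⟨hk1, hkb.le⟩]
    have h5 := exp_mul_le_of_two_le hc0 hc ha hk1' hks hL hL' h3 hlk.le hkb.le
    have h6 : exp ((exp (lam * k) - 1) / a) ≤ exp (24 * c * (k * (log (k * b) / 2))) := by
      rw [exp_le_exp, div_le_iff₀ ha]
      linarith
    have h7 : √(k * b) ^ k = exp (k * (log (k * b) / 2)) := by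
      rw [exp_nat_mul, exp_half, exp_log (by linarith)]
    have h8 : exp (24 * c * (k * (log (k * b) / 2))) ≤ 1 + 24 * c * √(k * b) ^ k := by
      have h9 : (1 : ℝ) ≤ √(k * b) ^ k := by
        apply one_le_pow₀
        rw [Real.one_le_sqrt]
        linarith
      have h10 := exp_mul_log_one_add_le (t := 24 * c) (a := √(k * b) ^ k - 1)
        (by linarith) (by positivity) (by linarith)
      rw [add_sub_cancel, h7, log_exp] at h10
      rw [h7]
      linarith
    linarith

end ExpBounds

section MomentBound

open Finset

variable {α β : Type*} [Fintype α] [DecidableEq α] [Fintype β] [DecidableEq β]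

lemma log_exp_one_mul_choose_le {d s : ℕ} (hs : 1 ≤ s) (hsd : s ≤ d) :
    Real.log (Real.exp 1 * d.choose s) ≤
      1 + s * (1 + Real.log (s * ((d : ℝ) / (s : ℝ) ^ 2))) := by
  have hs' : (0 : ℝ) < s := by exact_mod_cast hs
  have hd' : (0 : ℝ) < d := by exact_mod_cast hs.trans hsd
  have hC : (0 : ℝ) < d.choose s := by exact_mod_cast Nat.choose_pos hsd
  have h : Real.log (d.choose s) ≤ s * (1 + Real.log (d / s)) := by
    refine (Real.log_le_log hC (choose_le_exp_mul_div_pow hs)).trans_eq ?_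
    rw [Real.log_pow, Real.log_mul (Real.exp_pos 1).ne' (by positivity), Real.log_exp]
  rw [Real.log_mul (Real.exp_pos 1).ne' hC.ne', Real.log_exp,
    show (s : ℝ) * ((d : ℝ) / (s : ℝ) ^ 2) = d / s by field_simp]
  linarith

lemma one_le_log_exp_one_mul_choose {d s : ℕ} (hsd : s ≤ d) :
    1 ≤ Real.log (Real.exp 1 * d.choose s) := by
  have hC : (1 : ℝ) ≤ d.choose s := by exact_mod_cast Nat.choose_pos hsd
  rw [Real.log_mul (Real.exp_pos 1).ne' (by positivity), Real.log_exp]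
  linarith [Real.log_nonneg hC]

lemma exp_one_div_mul_sqrt_le {x : ℝ} (hx : 32 ≤ x) : Real.exp 1 / x * √x ≤ 1 / 2 := by
  have h1 : (5.6 : ℝ) ≤ √x := Real.le_sqrt_of_sq_le (by norm_num; linarith)
  have h2 : Real.exp 1 / x * √x = Real.exp 1 / √x := by
    have h3 : √x * √x = x := Real.mul_self_sqrt (by linarith)
    have h4 : 0 < √x := by linarith
    rw [div_mul_eq_mul_div, div_eq_div_iff (by linarith) h4.ne', mul_assoc, h3]
  rw [h2, div_le_iff₀ (by linarith)]
  linarith [Real.exp_one_lt_d9]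

lemma sum_tail_le {s : ℕ} (hs : s ≤ Fintype.card α) {S : Finset α} (hS : #S = s) {b : ℝ}
    (hb : b = (Fintype.card α : ℝ) / (s : ℝ) ^ 2) :
    ∑ T ∈ powersetCard s (univ : Finset α),
      (if 1 ≤ #(S ∩ T) ∧ 32 ≤ #(S ∩ T) * b then √(#(S ∩ T) * b) ^ #(S ∩ T) else 0) ≤
      (Fintype.card α).choose s := by
  have hmaps : ∀ T ∈ powersetCard s (univ : Finset α), #(S ∩ T) ∈ range (s + 1) := fun T _ ↦ by
    rw [mem_range, ← hS]
    exact Nat.lt_succ_of_le (card_le_card inter_subset_left)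
  rw [← sum_fiberwise_of_maps_to hmaps]
  have hk : ∀ k ∈ range (s + 1), ∑ T ∈ powersetCard s (univ : Finset α) with #(S ∩ T) = k,
      (if 1 ≤ #(S ∩ T) ∧ 32 ≤ #(S ∩ T) * b then √(#(S ∩ T) * b) ^ #(S ∩ T) else 0) ≤
      (if k = 0 then 0 else (Fintype.card α).choose s * (1 / 2 : ℝ) ^ k) := by
    intro k _
    rw [sum_congr rfl (g := fun _ ↦ if 1 ≤ k ∧ 32 ≤ k * b then √(k * b) ^ k else 0)
      fun T hT ↦ by rw [(mem_filter.1 hT).2], sum_const, nsmul_eq_mul]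
    split_ifs with h1 h2 h2
    · omega
    · have h3 := card_filter_card_inter_eq_le hs hS h1.1
      rw [← hb] at h3
      calc _ ≤ (Fintype.card α).choose s * (Real.exp 1 / (k * b)) ^ k * √(k * b) ^ k := by
            gcongr
        _ = (Fintype.card α).choose s * (Real.exp 1 / (k * b) * √(k * b)) ^ k := by
            rw [mul_assoc, ← mul_pow]
        _ ≤ _ := by
            have hkb : 0 ≤ k * b := by linarith [h1.2]
            gcongr
            exact exp_one_div_mul_sqrt_le h1.2
    · simp
    · rw [mul_zero]; positivity
  refine (sum_le_sum hk).trans ?_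
  rw [sum_range_succ']
  simp only [Nat.add_eq_zero_iff, one_ne_zero, and_false, if_false, if_true, add_zero, pow_succ]
  rw [← mul_sum, ← sum_mul]
  have hg : ∑ i ∈ range s, (1 / 2 : ℝ) ^ i ≤ 2 := sum_geometric_two_le s
  have hC : (0 : ℝ) ≤ (Fintype.card α).choose s := by positivity
  nlinarith

lemma sum_exp_div_le {s : ℕ} (hs1 : 1 ≤ s) (hs : s ≤ Fintype.card α) {S : Finset α} (hS : #S = s)
    {lam c a b : ℝ} (hc0 : 0 < c) (hc : c ≤ 1 / 32) (hlam : 0 ≤ lam) (ha : 0 < a)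
    (hb : b = (Fintype.card α : ℝ) / (s : ℝ) ^ 2)
    (h1 : lam ≤ c * (a * Real.log (1 + b))) (h2 : lam ≤ c * (b * Real.log (1 + a)))
    (h3 : lam * s ≤
      2 * c * Real.log (1 + a * Real.log (Real.exp 1 * (Fintype.card α).choose s))) :
    ∑ T ∈ powersetCard s (univ : Finset α), Real.exp ((Real.exp (lam * #(S ∩ T)) - 1) / a) ≤
      (1 + 104 * c) * (Fintype.card α).choose s := by
  set C : ℝ := ((Fintype.card α).choose s : ℝ) with hC
  have hCpos : 0 < C := by rw [hC]; exact_mod_cast Nat.choose_pos hs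
  have hb0 : 0 < b := by
    have h4 : (0 : ℝ) < Fintype.card α := by exact_mod_cast hs1.trans hs
    have h5 : (0 : ℝ) < s := by exact_mod_cast hs1
    rw [hb]; positivity
  have hpt : ∀ T ∈ powersetCard s (univ : Finset α),
      Real.exp ((Real.exp (lam * #(S ∩ T)) - 1) / a) ≤
        (1 + (Real.exp (8 * c * Real.log (1 + b)) - 1)) ^ #(S ∩ T) + (Real.exp (32 * c) - 1) +
        24 * c * if 1 ≤ #(S ∩ T) ∧ 32 ≤ #(S ∩ T) * b
          then √(#(S ∩ T) * b) ^ #(S ∩ T) else 0 := by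
    intro T _
    have hks : (#(S ∩ T) : ℝ) ≤ s := by
      rw [← hS]; exact_mod_cast card_le_card inter_subset_left
    have hLle := log_exp_one_mul_choose_le hs1 hs
    rw [← hb] at hLle
    rw [add_sub_cancel, mul_ite, mul_zero]
    exact exp_div_le hc0 hc hlam ha hb0 hks (one_le_log_exp_one_mul_choose hs) hLle h1 h2 h3
  have hx : 0 ≤ Real.exp (8 * c * Real.log (1 + b)) - 1 := by
    have : 0 ≤ Real.log (1 + b) := Real.log_nonneg (by linarith)
    rw [sub_nonneg]
    exact Real.one_le_exp (by positivity)
  have hexp : Real.exp ((Real.exp (8 * c * Real.log (1 + b)) - 1) *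
      ((s : ℝ) ^ 2 / Fintype.card α)) ≤ 1 + 16 * c := by
    have h6 := exp_mul_log_one_add_le (t := 8 * c) hb0.le (by linarith) (by linarith)
    have h7 : (Real.exp (8 * c * Real.log (1 + b)) - 1) * ((s : ℝ) ^ 2 / Fintype.card α) ≤
        8 * c := by
      rw [← inv_div, ← hb, ← div_eq_mul_inv, div_le_iff₀ hb0]
      linarith
    have h8 := exp_sub_one_le_two_mul (x := 8 * c) (by linarith) (by linarith)
    linarith [Real.exp_le_exp.2 h7]
  have h9 := exp_sub_one_le_two_mul (x := 32 * c) (by linarith) (by linarith)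
  refine (sum_le_sum hpt).trans ?_
  rw [sum_add_distrib, sum_add_distrib, ← mul_sum, sum_const, card_powersetCard, card_univ,
    nsmul_eq_mul, ← hC]
  have t1 := (sum_pow_card_inter_le hs hS hx).trans (mul_le_mul_of_nonneg_left hexp hCpos.le)
  have t2 : C * (Real.exp (32 * c) - 1) ≤ C * (64 * c) := by gcongr; linarith
  have t3 := mul_le_mul_of_nonneg_left (sum_tail_le hs hS hb) (show 0 ≤ 24 * c by linarith)
  linarith

lemma sum_exp_mul_card_inter_le {s₁ s₂ : ℕ} (hs₁ : 1 ≤ s₁) (hsd₁ : s₁ ≤ Fintype.card α)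
    (hs₂ : 1 ≤ s₂) (hsd₂ : s₂ ≤ Fintype.card β) {S₁ : Finset α} (hS₁ : #S₁ = s₁)
    {S₂ : Finset β} (hS₂ : #S₂ = s₂) {lam c : ℝ} (hc0 : 0 < c) (hc : c ≤ 1 / 32) (hlam : 0 ≤ lam)
    (h1 : lam ≤ c * phi s₁ s₂ (Fintype.card α) (Fintype.card β))
    (h2 : lam ≤ c * phi s₂ s₁ (Fintype.card β) (Fintype.card α))
    (h3 : lam ≤ 2 * c * psi s₂ s₁ (Fintype.card β) (Fintype.card α)) :
    ∑ T₂ ∈ powersetCard s₂ (univ : Finset β), ∑ T₁ ∈ powersetCard s₁ (univ : Finset α),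
      Real.exp (lam * (#(S₁ ∩ T₁) * #(S₂ ∩ T₂))) ≤
      (1 + 104 * c) * ((Fintype.card α).choose s₁ * (Fintype.card β).choose s₂) := by
  have hs₁' : (0 : ℝ) < s₁ := by exact_mod_cast hs₁
  have hs₂' : (0 : ℝ) < s₂ := by exact_mod_cast hs₂
  have hd₁' : (0 : ℝ) < Fintype.card α := by exact_mod_cast hs₁.trans hsd₁
  set a : ℝ := (Fintype.card α : ℝ) / (s₁ : ℝ) ^ 2 with ha
  have ha0 : 0 < a := by positivity
  have hin : ∀ T₂ ∈ powersetCard s₂ (univ : Finset β),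
      ∑ T₁ ∈ powersetCard s₁ (univ : Finset α), Real.exp (lam * (#(S₁ ∩ T₁) * #(S₂ ∩ T₂))) ≤
      (Fintype.card α).choose s₁ * Real.exp ((Real.exp (lam * #(S₂ ∩ T₂)) - 1) / a) := by
    intro T₂ _
    have hx : 0 ≤ Real.exp (lam * #(S₂ ∩ T₂)) - 1 := by
      rw [sub_nonneg]
      exact Real.one_le_exp (by positivity)
    have h := sum_pow_card_inter_le hsd₁ hS₁ hx
    rw [← inv_div, ← ha, ← div_eq_mul_inv] at h
    refine le_trans (le_of_eq (sum_congr rfl fun T₁ _ ↦ ?_)) h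
    rw [add_sub_cancel, ← Real.exp_nat_mul]
    congr 1
    ring
  have h3' : lam * s₂ ≤
      2 * c * Real.log (1 + a * Real.log (Real.exp 1 * (Fintype.card β).choose s₂)) := by
    have := mul_le_mul_of_nonneg_right h3 hs₂'.le
    refine this.trans_eq ?_
    rw [psi, ← ha]
    field_simp
  refine (sum_le_sum hin).trans ?_
  rw [← mul_sum]
  have hfin := mul_le_mul_of_nonneg_left (sum_exp_div_le hs₂ hsd₂ hS₂ hc0 hc hlam ha0 rfl h1 h2 h3')
    (show (0 : ℝ) ≤ (Fintype.card α).choose s₁ by positivity)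
  linarith

lemma sum_exp_mul_card_inter_le_of_le_rateR {d₁ d₂ s₁ s₂ : ℕ} (hs₁ : 1 ≤ s₁) (hsd₁ : s₁ ≤ d₁)
    (hs₂ : 1 ≤ s₂) (hsd₂ : s₂ ≤ d₂) {S₁ : Finset (Fin d₁)} (hS₁ : #S₁ = s₁)
    {S₂ : Finset (Fin d₂)} (hS₂ : #S₂ = s₂) {lam c : ℝ} (hc0 : 0 < c) (hc : c ≤ 1 / 32)
    (hlam : 0 ≤ lam) (h : lam ≤ c * rateR s₁ s₂ d₁ d₂) :
    ∑ T₁ ∈ powersetCard s₁ (univ : Finset (Fin d₁)), ∑ T₂ ∈ powersetCard s₂ (univ : Finset (Fin d₂)),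
      Real.exp (lam * (#(S₁ ∩ T₁) * #(S₂ ∩ T₂))) ≤
      (1 + 104 * c) * (d₁.choose s₁ * d₂.choose s₂) := by
  have h12 : lam ≤ c * phi s₁ s₂ d₁ d₂ :=
    h.trans (mul_le_mul_of_nonneg_left ((min_le_right _ _).trans (min_le_left _ _)) hc0.le)
  have h21 : lam ≤ c * phi s₂ s₁ d₂ d₁ :=
    h.trans (mul_le_mul_of_nonneg_left ((min_le_right _ _).trans (min_le_right _ _)) hc0.le)
  have hpsi : lam ≤ c * (psi s₁ s₂ d₁ d₂ + psi s₂ s₁ d₂ d₁) :=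
    h.trans (mul_le_mul_of_nonneg_left (min_le_left _ _) hc0.le)
  rcases le_total (psi s₁ s₂ d₁ d₂) (psi s₂ s₁ d₂ d₁) with hle | hle
  · rw [sum_comm]
    have := sum_exp_mul_card_inter_le (α := Fin d₁) (β := Fin d₂) hs₁ (by simpa) hs₂ (by simpa)
      hS₁ hS₂ hc0 hc hlam (by simpa using h12) (by simpa using h21)
      (by simp only [Fintype.card_fin]; nlinarith)
    simpa only [Fintype.card_fin] using this
  · have := sum_exp_mul_card_inter_le (α := Fin d₂) (β := Fin d₁) hs₂ (by simpa) hs₁ (by simpa)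
      hS₂ hS₁ hc0 hc hlam (by simpa using h21) (by simpa using h12)
      (by simp only [Fintype.card_fin]; nlinarith)
    simp only [Fintype.card_fin] at this
    rw [mul_comm (d₁.choose s₁ : ℝ)]
    refine le_trans (le_of_eq ?_) this
    exact sum_congr rfl fun T₁ _ ↦ sum_congr rfl fun T₂ _ ↦ by rw [mul_comm (#(S₁ ∩ T₁) : ℝ)]

end MomentBound

section SecondMoment

lemma pi_withDensity_ofReal {ι : Type*} [Fintype ι] {E : ι → Type*} [∀ i, MeasurableSpace (E i)]
    (ν : ∀ i, Measure (E i)) [∀ i, IsProbabilityMeasure (ν i)] (f : ∀ i, E i → ℝ)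
    (hf0 : ∀ i x, 0 ≤ f i x) (hfi : ∀ i, Integrable (f i) (ν i)) :
    (Measure.pi fun i ↦ (ν i).withDensity fun x ↦ ENNReal.ofReal (f i x)) =
      (Measure.pi ν).withDensity fun y ↦ ENNReal.ofReal (∏ i, f i (y i)) := by
  have : ∀ i, IsFiniteMeasure ((ν i).withDensity fun x ↦ ENNReal.ofReal (f i x)) :=
    fun i ↦ isFiniteMeasure_withDensity_ofReal (hfi i).2
  refine Measure.pi_eq fun s hs ↦ ?_
  rw [withDensity_apply _ (MeasurableSet.univ_pi hs), Measure.restrict_pi_pi,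
    ← ofReal_integral_eq_lintegral_ofReal
      (Integrable.fintype_prod_dep fun i ↦ (hfi i).mono_measure Measure.restrict_le_self)
      (ae_of_all _ fun y ↦ Finset.prod_nonneg fun i _ ↦ hf0 i _),
    integral_fintype_prod_eq_prod,
    ENNReal.ofReal_prod_of_nonneg fun i _ ↦ integral_nonneg fun x ↦ hf0 i x]
  refine Finset.prod_congr rfl fun i _ ↦ ?_
  rw [withDensity_apply _ (hs i), ofReal_integral_eq_lintegral_ofReal
    ((hfi i).mono_measure Measure.restrict_le_self) (ae_of_all _ fun x ↦ hf0 i x)]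

lemma gaussianReal_one_eq_withDensity (x : ℝ) :
    gaussianReal x 1 = (gaussianReal 0 1).withDensity
      fun y ↦ ENNReal.ofReal (Real.exp (x * y - x ^ 2 / 2)) := by
  rw [gaussianReal_of_var_ne_zero _ one_ne_zero, gaussianReal_of_var_ne_zero _ one_ne_zero,
    ← withDensity_mul _ (measurable_gaussianPDF 0 1) (by fun_prop)]
  congr 1
  ext y
  simp only [Pi.mul_apply, gaussianPDF]
  rw [← ENNReal.ofReal_mul (gaussianPDFReal_nonneg _ _ _)]
  congr 1
  simp only [gaussianPDFReal]
  rw [mul_assoc _ (Real.exp _), ← Real.exp_add]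
  congr 2
  simp only [NNReal.coe_one]
  ring

lemma integrable_exp_mul_sub (x c : ℝ) :
    Integrable (fun y ↦ Real.exp (x * y - c)) (gaussianReal 0 1) := by
  simp_rw [Real.exp_sub]
  exact (integrable_exp_mul_gaussianReal x).div_const _

lemma integral_exp_mul_sub (x c : ℝ) :
    ∫ y, Real.exp (x * y - c) ∂(gaussianReal 0 1) = Real.exp (x ^ 2 / 2 - c) := by
  simp_rw [Real.exp_sub, integral_div]
  have := congrFun (mgf_id_gaussianReal (μ := 0) (v := 1)) x
  simp only [mgf, id] at this
  rw [this]
  simp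

/-- The likelihood ratio of `Pmeas X` with respect to `Pmeas 0`. -/
noncomputable def likelihood {d₁ d₂ : ℕ} (X y : Fin d₁ → Fin d₂ → ℝ) : ℝ :=
  ∏ i, ∏ j, Real.exp (X i j * y i j - X i j ^ 2 / 2)

variable {d₁ d₂ : ℕ}

instance isProbabilityMeasure_Pmeas (X : Fin d₁ → Fin d₂ → ℝ) :
    IsProbabilityMeasure (Pmeas d₁ d₂ X) := by
  unfold Pmeas; infer_instance

lemma likelihood_nonneg (X y : Fin d₁ → Fin d₂ → ℝ) : 0 ≤ likelihood X y :=
  Finset.prod_nonneg fun _ _ ↦ Finset.prod_nonneg fun _ _ ↦ (Real.exp_pos _).le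

lemma integrable_prod_exp_mul_sub (X c : Fin d₁ → Fin d₂ → ℝ) :
    Integrable (fun y ↦ ∏ i, ∏ j, Real.exp (X i j * y i j - c i j)) (Pmeas d₁ d₂ 0) :=
  Integrable.fintype_prod_dep (f := fun i (z : Fin d₂ → ℝ) ↦
    ∏ j, Real.exp (X i j * z j - c i j)) fun i ↦
    Integrable.fintype_prod_dep (f := fun j (z : ℝ) ↦ Real.exp (X i j * z - c i j)) fun _ ↦
      integrable_exp_mul_sub _ _

lemma integral_prod_exp_mul_sub (X c : Fin d₁ → Fin d₂ → ℝ) :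
    ∫ y, ∏ i, ∏ j, Real.exp (X i j * y i j - c i j) ∂(Pmeas d₁ d₂ 0) =
      Real.exp (∑ i, ∑ j, (X i j ^ 2 / 2 - c i j)) := by
  unfold Pmeas
  rw [integral_fintype_prod_eq_prod (fun i (z : Fin d₂ → ℝ) ↦
    ∏ j, Real.exp (X i j * z j - c i j)), Real.exp_sum]
  refine Finset.prod_congr rfl fun i _ ↦ ?_
  rw [integral_fintype_prod_eq_prod (fun j (z : ℝ) ↦ Real.exp (X i j * z - c i j)), Real.exp_sum]
  exact Finset.prod_congr rfl fun j _ ↦ integral_exp_mul_sub _ _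

lemma Pmeas_eq_withDensity (X : Fin d₁ → Fin d₂ → ℝ) :
    Pmeas d₁ d₂ X = (Pmeas d₁ d₂ 0).withDensity fun y ↦ ENNReal.ofReal (likelihood X y) := by
  unfold Pmeas
  simp_rw [gaussianReal_one_eq_withDensity (X _ _)]
  have h : ∀ i, (Measure.pi fun j : Fin d₂ ↦ (gaussianReal 0 1).withDensity fun y ↦
      ENNReal.ofReal (Real.exp (X i j * y - X i j ^ 2 / 2))) =
      (Measure.pi fun _ : Fin d₂ ↦ gaussianReal 0 1).withDensity fun y ↦
        ENNReal.ofReal (∏ j, Real.exp (X i j * y j - X i j ^ 2 / 2)) := fun i ↦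
    pi_withDensity_ofReal (fun _ ↦ gaussianReal 0 1)
      (fun j (y : ℝ) ↦ Real.exp (X i j * y - X i j ^ 2 / 2)) (fun _ _ ↦ (Real.exp_pos _).le)
      fun _ ↦ integrable_exp_mul_sub _ _
  simp_rw [h]
  exact pi_withDensity_ofReal (fun _ ↦ Measure.pi fun _ : Fin d₂ ↦ gaussianReal 0 1)
      (fun i (y : Fin d₂ → ℝ) ↦ ∏ j, Real.exp (X i j * y j - X i j ^ 2 / 2))
      (fun _ _ ↦ Finset.prod_nonneg fun _ _ ↦ (Real.exp_pos _).le)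
      fun i ↦ Integrable.fintype_prod_dep
        (f := fun j (z : ℝ) ↦ Real.exp (X i j * z - X i j ^ 2 / 2)) fun _ ↦
        integrable_exp_mul_sub _ _

lemma integrable_likelihood (X : Fin d₁ → Fin d₂ → ℝ) :
    Integrable (likelihood X) (Pmeas d₁ d₂ 0) :=
  integrable_prod_exp_mul_sub X fun i j ↦ X i j ^ 2 / 2

lemma integral_likelihood (X : Fin d₁ → Fin d₂ → ℝ) :
    ∫ y, likelihood X y ∂(Pmeas d₁ d₂ 0) = 1 := by
  unfold likelihood
  rw [integral_prod_exp_mul_sub]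
  simp

lemma toReal_Pmeas_eq_setIntegral (X : Fin d₁ → Fin d₂ → ℝ) {A : Set (Fin d₁ → Fin d₂ → ℝ)}
    (hA : MeasurableSet A) :
    (Pmeas d₁ d₂ X A).toReal = ∫ y in A, likelihood X y ∂(Pmeas d₁ d₂ 0) := by
  rw [Pmeas_eq_withDensity X, withDensity_apply _ hA, ← ofReal_integral_eq_lintegral_ofReal
    (integrable_likelihood X).integrableOn (ae_of_all _ fun y ↦ likelihood_nonneg X y),
    ENNReal.toReal_ofReal (integral_nonneg fun y ↦ likelihood_nonneg X y)]

lemma likelihood_mul_likelihood (X X' y : Fin d₁ → Fin d₂ → ℝ) :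
    likelihood X y * likelihood X' y = ∏ i, ∏ j, Real.exp ((X + X') i j * y i j -
      (X i j ^ 2 / 2 + X' i j ^ 2 / 2)) := by
  unfold likelihood
  simp_rw [← Finset.prod_mul_distrib, ← Real.exp_add]
  refine Finset.prod_congr rfl fun i _ ↦ Finset.prod_congr rfl fun j _ ↦ ?_
  simp only [Pi.add_apply]
  congr 1
  ring

lemma integrable_likelihood_mul (X X' : Fin d₁ → Fin d₂ → ℝ) :
    Integrable (fun y ↦ likelihood X y * likelihood X' y) (Pmeas d₁ d₂ 0) := by
  simp_rw [likelihood_mul_likelihood]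
  exact integrable_prod_exp_mul_sub (X + X') fun i j ↦ X i j ^ 2 / 2 + X' i j ^ 2 / 2

lemma integral_likelihood_mul (X X' : Fin d₁ → Fin d₂ → ℝ) :
    ∫ y, likelihood X y * likelihood X' y ∂(Pmeas d₁ d₂ 0) =
      Real.exp (∑ i, ∑ j, X i j * X' i j) := by
  simp_rw [likelihood_mul_likelihood]
  rw [integral_prod_exp_mul_sub]
  congr 1
  refine Finset.sum_congr rfl fun i _ ↦ Finset.sum_congr rfl fun j _ ↦ ?_
  simp only [Pi.add_apply]
  ring

lemma type_two_error_le_iSup (s₁ s₂ : ℕ) (μ : ℝ)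
    (Δ : (Fin d₁ → Fin d₂ → ℝ) → Bool) (X : Fin d₁ → Fin d₂ → ℝ) (hX : X ∈ Theta d₁ d₂ s₁ s₂ μ) :
    (Pmeas d₁ d₂ X {y | Δ y = false}).toReal ≤
      ⨆ X ∈ Theta d₁ d₂ s₁ s₂ μ, (Pmeas d₁ d₂ X {y | Δ y = false}).toReal := by
  refine le_ciSup_of_le ⟨1, ?_⟩ X ?_
  · rintro _ ⟨Y, rfl⟩
    exact Real.iSup_le (fun _ ↦ measureReal_le_one) zero_le_one
  · rw [ciSup_pos hX]

/-- Le Cam's second moment method for a uniform prior on a finite family `Y` of alternatives. -/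
lemma one_sub_le_risk {ι : Type*} {s₁ s₂ : ℕ} {μ : ℝ} (A : Finset ι) (hA : A.Nonempty)
    (Y : ι → Fin d₁ → Fin d₂ → ℝ) (hY : ∀ i ∈ A, Y i ∈ Theta d₁ d₂ s₁ s₂ μ) {t : ℝ} (ht : 0 < t)
    (hmom : ∑ i ∈ A, ∑ i' ∈ A, Real.exp (∑ k, ∑ l, Y i k l * Y i' k l) ≤
      (1 + t ^ 2) * (A.card : ℝ) ^ 2)
    {Δ : (Fin d₁ → Fin d₂ → ℝ) → Bool} (hΔ : Measurable Δ) :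
    1 - t ≤ risk d₁ d₂ s₁ s₂ μ Δ := by
  set P := Pmeas d₁ d₂ (0 : Fin d₁ → Fin d₂ → ℝ) with hP
  set F : Set (Fin d₁ → Fin d₂ → ℝ) := {y | Δ y = false} with hF
  have hFm : MeasurableSet F := hΔ (measurableSet_singleton false)
  have hn : (0 : ℝ) < A.card := by exact_mod_cast hA.card_pos
  set M : (Fin d₁ → Fin d₂ → ℝ) → ℝ := fun y ↦ (∑ i ∈ A, likelihood (Y i) y) / A.card with hM
  have hMi : Integrable M P :=
    (integrable_finsetSum _ fun i _ ↦ integrable_likelihood (Y i)).div_const _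
  have hM1 : ∫ y, M y ∂P = 1 := by
    rw [integral_div, integral_finsetSum _ fun i _ ↦ integrable_likelihood (Y i)]
    rw [Finset.sum_congr rfl fun i _ ↦ integral_likelihood (Y i)]
    simp [hn.ne']
  have hMsq : ∀ y, M y ^ 2 =
      (∑ i ∈ A, ∑ i' ∈ A, likelihood (Y i) y * likelihood (Y i') y) / (A.card : ℝ) ^ 2 := by
    intro y
    rw [hM, div_pow, sq, Finset.sum_mul_sum]
  have hMsqi : Integrable (fun y ↦ M y ^ 2) P := by
    simp_rw [hMsq]
    exact (integrable_finsetSum _ fun i _ ↦ integrable_finsetSum _ fun i' _ ↦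
      integrable_likelihood_mul (Y i) (Y i')).div_const _
  have hM2 : ∫ y, M y ^ 2 ∂P ≤ 1 + t ^ 2 := by
    simp_rw [hMsq]
    rw [integral_div, integral_finsetSum _ fun i _ ↦ integrable_finsetSum _ fun i' _ ↦
      integrable_likelihood_mul (Y i) (Y i'), div_le_iff₀ (by positivity)]
    refine le_trans (le_of_eq (Finset.sum_congr rfl fun i _ ↦ ?_)) hmom
    rw [integral_finsetSum _ fun i' _ ↦ integrable_likelihood_mul (Y i) (Y i')]
    exact Finset.sum_congr rfl fun i' _ ↦ integral_likelihood_mul _ _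
  have hsup : ∫ y in F, M y ∂P ≤
      ⨆ X ∈ Theta d₁ d₂ s₁ s₂ μ, (Pmeas d₁ d₂ X F).toReal := by
    rw [integral_div, integral_finsetSum _ fun i _ ↦ (integrable_likelihood (Y i)).integrableOn,
      div_le_iff₀ hn, mul_comm, ← nsmul_eq_mul]
    refine Finset.sum_le_card_nsmul _ _ _ fun i hi ↦ ?_
    rw [← toReal_Pmeas_eq_setIntegral _ hFm]
    exact type_two_error_le_iSup s₁ s₂ μ Δ _ (hY i hi)
  have hcompl : (P {y | Δ y = true}).toReal = 1 - (P F).toReal := by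
    have : {y | Δ y = true} = Fᶜ := by ext y; simp [hF]
    rw [this]
    exact probReal_compl_eq_one_sub hFm
  have hPF : ∫ y in F, (1 : ℝ) ∂P = (P F).toReal := by
    rw [setIntegral_const, smul_eq_mul, mul_one]
    rfl
  -- the quadratic dominates the negative part of `M - 1`
  have hq : ∀ y, 1 - M y ≤ (M y ^ 2 - 2 * M y + 1) / (2 * t) + t / 2 := by
    intro y
    have : (M y ^ 2 - 2 * M y + 1) / (2 * t) + t / 2 - (1 - M y) =
        (M y - 1 + t) ^ 2 / (2 * t) := by
      field_simp
      ring
    have h0 : 0 ≤ (M y - 1 + t) ^ 2 / (2 * t) := by positivity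
    linarith
  have hi₁ : Integrable (fun y ↦ M y ^ 2 - 2 * M y) P := hMsqi.sub (hMi.const_mul 2)
  have hi₂ : Integrable (fun y ↦ M y ^ 2 - 2 * M y + 1) P := hi₁.add (integrable_const 1)
  have hqi : Integrable (fun y ↦ (M y ^ 2 - 2 * M y + 1) / (2 * t) + t / 2) P :=
    (hi₂.div_const _).add (integrable_const _)
  have hint : ∫ y, ((M y ^ 2 - 2 * M y + 1) / (2 * t) + t / 2) ∂P ≤ t := by
    rw [integral_add (hi₂.div_const _) (integrable_const _), integral_div,
      integral_add hi₁ (integrable_const 1), integral_sub hMsqi (hMi.const_mul 2),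
      integral_const_mul, hM1]
    simp only [integral_const, probReal_univ, smul_eq_mul, one_mul]
    have : (∫ y, M y ^ 2 ∂P) - 2 * 1 + 1 ≤ t ^ 2 := by linarith
    calc _ ≤ t ^ 2 / (2 * t) + t / 2 := by gcongr
      _ = t := by field_simp; ring
  have hset : ∫ y in F, (1 - M y) ∂P ≤ t := by
    calc ∫ y in F, (1 - M y) ∂P
        ≤ ∫ y in F, ((M y ^ 2 - 2 * M y + 1) / (2 * t) + t / 2) ∂P :=
          setIntegral_mono ((integrable_const 1).sub hMi).integrableOn hqi.integrableOn hq
      _ ≤ ∫ y, ((M y ^ 2 - 2 * M y + 1) / (2 * t) + t / 2) ∂P := by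
          refine setIntegral_le_integral hqi (ae_of_all _ fun y ↦ ?_)
          have : M y ^ 2 - 2 * M y + 1 = (M y - 1) ^ 2 := by ring
          simp only [Pi.zero_apply]
          rw [this]
          positivity
      _ ≤ t := hint
  rw [integral_sub (integrable_const 1).integrableOn hMi.integrableOn, hPF] at hset
  unfold risk
  rw [hcompl]
  linarith

end SecondMoment

/-- The matrix equal to `μ` on the block `S₁ × S₂` and to `0` elsewhere. -/
noncomputable def blockMatrix {d₁ d₂ : ℕ} (μ : ℝ) (S : Finset (Fin d₁) × Finset (Fin d₂)) :
    Fin d₁ → Fin d₂ → ℝ :=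
  fun i j ↦ (if i ∈ S.1 then μ else 0) * (if j ∈ S.2 then 1 else 0)

lemma blockMatrix_mem_Theta {d₁ d₂ s₁ s₂ : ℕ} (μ : ℝ) {S : Finset (Fin d₁) × Finset (Fin d₂)}
    (h₁ : S.1.card = s₁) (h₂ : S.2.card = s₂) : blockMatrix μ S ∈ Theta d₁ d₂ s₁ s₂ μ := by
  refine ⟨S.1, S.2, h₁, h₂, fun i j hi hj ↦ ?_, fun i j hij ↦ ?_⟩
  · simp [blockMatrix, hi, hj]
  · simp only [blockMatrix]
    split_ifs with hi hj <;> simp_all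

lemma sum_blockMatrix_mul {d₁ d₂ : ℕ} (μ : ℝ) (S T : Finset (Fin d₁) × Finset (Fin d₂)) :
    ∑ i, ∑ j, blockMatrix μ S i j * blockMatrix μ T i j =
      μ ^ 2 * ((S.1 ∩ T.1).card * (S.2 ∩ T.2).card) := by
  have h : ∀ i j, blockMatrix μ S i j * blockMatrix μ T i j =
      (if i ∈ S.1 ∩ T.1 then μ ^ 2 else 0) * (if j ∈ S.2 ∩ T.2 then 1 else 0) := by
    intro i j
    simp only [blockMatrix, Finset.mem_inter]
    split_ifs <;> first | ring1 | simp_all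
  simp_rw [h, ← Finset.mul_sum, ← Finset.sum_mul]
  rw [Finset.sum_ite_mem, Finset.sum_ite_mem]
  simp only [Finset.univ_inter, Finset.sum_const, nsmul_eq_mul]
  ring

lemma le_risk_of_sq_le {d₁ d₂ s₁ s₂ : ℕ} (hs₁ : 1 ≤ s₁) (hsd₁ : s₁ ≤ d₁) (hs₂ : 1 ≤ s₂)
    (hsd₂ : s₂ ≤ d₂) {c μ : ℝ} (hc0 : 0 < c) (hc : c ≤ 1 / 32)
    (hμ : μ ^ 2 ≤ c * rateR s₁ s₂ d₁ d₂) {t : ℝ} (ht : 0 < t) (hct : 104 * c ≤ t ^ 2)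
    {Δ : (Fin d₁ → Fin d₂ → ℝ) → Bool} (hΔ : Measurable Δ) :
    1 - t ≤ risk d₁ d₂ s₁ s₂ μ Δ := by
  refine one_sub_le_risk (Finset.powersetCard s₁ Finset.univ ×ˢ Finset.powersetCard s₂ Finset.univ)
    ?_ (blockMatrix μ) ?_ ht ?_ hΔ
  · simp [Finset.powersetCard_nonempty, hsd₁, hsd₂]
  · intro S hS
    simp only [Finset.mem_product, Finset.mem_powersetCard_univ] at hS
    exact blockMatrix_mem_Theta μ hS.1 hS.2
  · have h : ∀ S ∈ Finset.powersetCard s₁ (Finset.univ : Finset (Fin d₁)) ×ˢ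
        Finset.powersetCard s₂ (Finset.univ : Finset (Fin d₂)),
        ∑ T ∈ Finset.powersetCard s₁ (Finset.univ : Finset (Fin d₁)) ×ˢ
          Finset.powersetCard s₂ (Finset.univ : Finset (Fin d₂)),
          Real.exp (∑ k, ∑ l, blockMatrix μ S k l * blockMatrix μ T k l) ≤
        (1 + 104 * c) * (d₁.choose s₁ * d₂.choose s₂) := by
      intro S hS
      simp only [Finset.mem_product, Finset.mem_powersetCard_univ] at hS
      simp_rw [sum_blockMatrix_mul]
      rw [Finset.sum_product]
      exact sum_exp_mul_card_inter_le_of_le_rateR hs₁ hsd₁ hs₂ hsd₂ hS.1 hS.2 hc0 hc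
        (sq_nonneg μ) hμ
    refine (Finset.sum_le_card_nsmul _ _ _ h).trans ?_
    simp only [Finset.card_product, Finset.card_powersetCard, Finset.card_univ, Fintype.card_fin,
      nsmul_eq_mul, Nat.cast_mul]
    calc _ = (1 + 104 * c) * ((d₁.choose s₁ : ℝ) * d₂.choose s₂) ^ 2 := by ring
      _ ≤ _ := by gcongr

lemma toReal_Pmeas_coord_le {d₁ d₂ : ℕ} (X : Fin d₁ → Fin d₂ → ℝ) (i : Fin d₁) (j : Fin d₂)
    (t : ℝ) : (Pmeas d₁ d₂ X {y | y i j ≤ t}).toReal = cdf (gaussianReal 0 1) (t - X i j) := by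
  have h₁ : MeasurePreserving (fun y : Fin d₁ → Fin d₂ → ℝ ↦ y i) (Pmeas d₁ d₂ X)
      (Measure.pi fun j ↦ gaussianReal (X i j) 1) := measurePreserving_eval _ i
  have h₂ := (measurePreserving_eval (fun j ↦ gaussianReal (X i j) 1) j).comp h₁
  have h₃ : gaussianReal (X i j) 1 = (gaussianReal 0 1).map (· + X i j) := by
    rw [gaussianReal_map_add_const, zero_add]
  have h₄ := h₂.measure_preimage (s := Set.Iic t) measurableSet_Iic.nullMeasurableSet
  rw [cdf_eq_real, measureReal_def]
  congr 1
  refine h₄.trans ?_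
  rw [h₃, Measure.map_apply (by fun_prop) measurableSet_Iic]
  congr 1
  ext y
  simp [le_sub_iff_add_le]

lemma exists_test_risk_lt {d₁ d₂ s₁ s₂ : ℕ} (hs₁ : 1 ≤ s₁) (hs₂ : 1 ≤ s₂) {η : ℝ} (hη : 0 < η) :
    ∃ μ : ℝ, 0 < μ ∧ ∃ Δ : (Fin d₁ → Fin d₂ → ℝ) → Bool,
      Measurable Δ ∧ risk d₁ d₂ s₁ s₂ μ Δ < η := by
  have htop : Filter.Tendsto (fun t ↦ 1 - ((cdf (gaussianReal 0 1) t) ^ d₂) ^ d₁) Filter.atTop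
      (nhds 0) := by
    simpa using (((tendsto_cdf_atTop (gaussianReal 0 1)).pow d₂).pow d₁).const_sub 1
  obtain ⟨t, ht⟩ := (htop.eventually_lt_const (half_pos hη)).exists
  obtain ⟨r, hr⟩ := ((tendsto_cdf_atBot (gaussianReal 0 1)).eventually_lt_const (half_pos hη)).exists
  set F : Set (Fin d₁ → Fin d₂ → ℝ) := Set.univ.pi fun _ ↦ Set.univ.pi fun _ ↦ Set.Iic t with hF
  have hFm : MeasurableSet F :=
    MeasurableSet.univ_pi fun _ ↦ MeasurableSet.univ_pi fun _ ↦ measurableSet_Iic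
  classical
  refine ⟨max (t - r) 1, by positivity, fun y ↦ !decide (y ∈ F), ?_, ?_⟩
  · exact (measurable_of_finite (fun b : Bool ↦ !b)).comp (measurable_to_bool (by
      simpa [Set.preimage] using hFm))
  · have h0 : (Pmeas d₁ d₂ 0 F).toReal = (cdf (gaussianReal 0 1) t ^ d₂) ^ d₁ := by
      rw [hF, Pmeas]
      simp_rw [Measure.pi_pi]
      simp [cdf_eq_real, measureReal_def]
    have h1 : {y : Fin d₁ → Fin d₂ → ℝ | (!decide (y ∈ F)) = true} = Fᶜ := by
      ext y; simp
    have h2 : {y : Fin d₁ → Fin d₂ → ℝ | (!decide (y ∈ F)) = false} = F := by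
      ext y; simp
    have h3 : (Pmeas d₁ d₂ 0 Fᶜ).toReal = 1 - (Pmeas d₁ d₂ 0 F).toReal :=
      probReal_compl_eq_one_sub hFm
    unfold risk
    rw [h1, h2, h3, h0]
    have h4 : ⨆ X ∈ Theta d₁ d₂ s₁ s₂ (max (t - r) 1), (Pmeas d₁ d₂ X F).toReal ≤ η / 2 := by
      refine Real.iSup_le (fun X ↦ Real.iSup_le (fun hX ↦ ?_) (by positivity)) (by positivity)
      obtain ⟨S₁, S₂, hS₁, hS₂, hX, -⟩ := hX
      obtain ⟨i, hi⟩ := Finset.card_pos.1 (show 0 < S₁.card by omega)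
      obtain ⟨j, hj⟩ := Finset.card_pos.1 (show 0 < S₂.card by omega)
      have h5 : F ⊆ {y | y i j ≤ t} := fun y hy ↦ hy i trivial j trivial
      have h6 : (Pmeas d₁ d₂ X F).toReal ≤ (Pmeas d₁ d₂ X {y | y i j ≤ t}).toReal :=
        measureReal_mono h5
      rw [toReal_Pmeas_coord_le] at h6
      have h7 : t - X i j ≤ r := by
        have := (le_max_left (t - r) 1).trans (hX i j hi hj)
        linarith
      exact h6.trans ((monotone_cdf _ h7).trans hr.le)
    linarith

/-- Lower bound on the minimax separation rate (Theorem 1, part 1). -/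
theorem lower_bound (η : ℝ) (hη0 : 0 < η) (hη1 : η < 1) :
    ∃ c : ℝ, 0 < c ∧
      ∀ (d₁ d₂ s₁ s₂ : ℕ), 0 < d₁ → 0 < d₂ →
        1 ≤ s₁ → s₁ ≤ d₁ → 1 ≤ s₂ → s₂ ≤ d₂ →
        (∀ μ : ℝ, 0 < μ → μ ^ 2 < c * rateR s₁ s₂ d₁ d₂ →
          ∀ Δ : (Fin d₁ → Fin d₂ → ℝ) → Bool, Measurable Δ →
            η ≤ risk d₁ d₂ s₁ s₂ μ Δ) ∧
        c * rateR s₁ s₂ d₁ d₂ ≤ (muStar η d₁ d₂ s₁ s₂) ^ 2 := by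
  have ht : 0 < 1 - η := by linarith
  have hc0 : 0 < (1 - η) ^ 2 / 104 := by positivity
  have hc : (1 - η) ^ 2 / 104 ≤ 1 / 32 := by nlinarith
  refine ⟨(1 - η) ^ 2 / 104, hc0, fun d₁ d₂ s₁ s₂ _ _ hs₁ hsd₁ hs₂ hsd₂ ↦ ?_⟩
  have hrisk : ∀ μ : ℝ, 0 < μ → μ ^ 2 < (1 - η) ^ 2 / 104 * rateR s₁ s₂ d₁ d₂ →
      ∀ Δ : (Fin d₁ → Fin d₂ → ℝ) → Bool, Measurable Δ → η ≤ risk d₁ d₂ s₁ s₂ μ Δ := by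
    intro μ _ hμ Δ hΔ
    have := le_risk_of_sq_le hs₁ hsd₁ hs₂ hsd₂ hc0 hc hμ.le ht (by linarith) hΔ
    linarith
  refine ⟨hrisk, ?_⟩
  have hsqrt : √((1 - η) ^ 2 / 104 * rateR s₁ s₂ d₁ d₂) ≤ muStar η d₁ d₂ s₁ s₂ := by
    refine le_csInf (exists_test_risk_lt hs₁ hs₂ hη0) ?_
    rintro μ ⟨hμ0, Δ, hΔ, hlt⟩
    rw [Real.sqrt_le_left hμ0.le]
    by_contra! h
    exact absurd (hrisk μ hμ0 h Δ hΔ) (not_le.2 hlt)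
  exact (Real.sqrt_le_left ((Real.sqrt_nonneg _).trans hsqrt)).1 hsqrt
end

section
/- (Adaptive upper bound.) For every η ∈ (0,1) and every constant C'' > 0 there exists a constant C > 0 such that for all positive integers d₁, d₂ with min(d₁,d₂) ≥ 8 there exists a single test Δ (depending only on d₁, d₂, η, C'' and not on the sparsity levels) with the following property: for all integers s₁*, s₂* with 3 ≤ s₁* ≤ d₁ and 3 ≤ s₂* ≤ d₂ satisfying s₁* + log log d₂ ≥ C''·log log d₁ and s₂* + log log d₁ ≥ C''·log log d₂, and for every μ > 0 with μ² ≥ C·R(s₁*,s₂*,d₁,d₂), it holds that P₀(Δ = 1) + sup_{X ∈ Θ(s₁*,s₂*,d₁,d₂,μ)} P_X(Δ = 0) ≤ η. -/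
open MeasureTheory ProbabilityTheory

lemma gaussian_upper_tail {m t : ℝ} (h : m ≤ t) :
    (gaussianReal m 1).real {x | t ≤ x} ≤ Real.exp (-(t - m) ^ 2 / 2) := by
  have hint : Integrable (fun x => Real.exp ((t - m) * id x)) (gaussianReal m 1) :=
    integrable_exp_mul_gaussianReal _
  refine (measure_ge_le_exp_mul_mgf (X := id) t (sub_nonneg.2 h) hint).trans ?_
  rw [mgf_id_gaussianReal, ← Real.exp_add]
  apply Real.exp_le_exp.2
  simp only [NNReal.coe_one]
  nlinarith

lemma gaussian_lower_tail {m t : ℝ} (h : t ≤ m) :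
    (gaussianReal m 1).real {x | x ≤ t} ≤ Real.exp (-(m - t) ^ 2 / 2) := by
  have hint : Integrable (fun x => Real.exp ((t - m) * id x)) (gaussianReal m 1) :=
    integrable_exp_mul_gaussianReal _
  refine (measure_le_le_exp_mul_mgf (X := id) t (sub_nonpos.2 h) hint).trans ?_
  rw [mgf_id_gaussianReal, ← Real.exp_add]
  apply Real.exp_le_exp.2
  simp only [NNReal.coe_one]
  nlinarith

lemma gaussian_upper_prob_mono {m t : ℝ} (h : 0 ≤ m) :
    (gaussianReal 0 1).real {x | t < x} ≤ (gaussianReal m 1).real {x | t < x} := by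
  have : gaussianReal m 1 = (gaussianReal 0 1).map (· + m) := by
    rw [gaussianReal_map_add_const, zero_add]
  rw [this, map_measureReal_apply (by fun_prop)
    (measurableSet_lt (g := fun x : ℝ => x) measurable_const measurable_id)]
  exact measureReal_mono (fun x hx => by simp at hx ⊢; linarith)

section Count

variable {Ω ι : Type*} [MeasurableSpace Ω] {P : Measure Ω} [Fintype ι]

lemma mgf_indicator_le [IsProbabilityMeasure P] {A : Set Ω} (hA : MeasurableSet A) (s : ℝ) :
    mgf (A.indicator fun _ => (1 : ℝ)) P s ≤ Real.exp ((Real.exp s - 1) * P.real A) := by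
  have h : (fun ω => Real.exp (s * A.indicator (fun _ => (1 : ℝ)) ω)) =
      fun ω => 1 + A.indicator (fun _ => Real.exp s - 1) ω := by
    ext ω
    by_cases hω : ω ∈ A <;> simp [hω]
  have : mgf (A.indicator fun _ => (1 : ℝ)) P s = (Real.exp s - 1) * P.real A + 1 := by
    rw [mgf, h, integral_add (integrable_const _) ((integrable_const _).indicator hA),
      integral_indicator_const _ hA]
    simp
    ring
  rw [this]
  exact Real.add_one_le_exp _

lemma mgf_count_le {W : ι → Ω → ℝ} (hW : iIndepFun W P) (hm : ∀ i, Measurable (W i))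
    (t s : ℝ) :
    mgf (∑ i, {ω | t < W i ω}.indicator fun _ => (1 : ℝ)) P s ≤
      Real.exp ((Real.exp s - 1) * ∑ i, P.real {ω | t < W i ω}) := by
  have := hW.isProbabilityMeasure
  have hA : ∀ i, MeasurableSet {ω | t < W i ω} := fun i => measurableSet_lt measurable_const (hm i)
  have hind : iIndepFun (fun i => {ω | t < W i ω}.indicator fun _ => (1 : ℝ)) P :=
    hW.comp (fun _ => {x | t < x}.indicator fun _ => (1 : ℝ))
      (fun _ => measurable_const.indicator (measurableSet_lt measurable_const measurable_id))
  rw [hind.mgf_sum (fun i => measurable_const.indicator (hA i)), Finset.mul_sum, Real.exp_sum]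
  exact Finset.prod_le_prod (fun i _ => mgf_nonneg) (fun i _ => mgf_indicator_le (hA i) s)

lemma integrable_exp_count [IsFiniteMeasure P] {W : ι → Ω → ℝ} (hm : ∀ i, Measurable (W i))
    (t s : ℝ) :
    Integrable (fun ω => Real.exp (s *
      (∑ i, {ω | t < W i ω}.indicator fun _ => (1 : ℝ)) ω)) P := by
  have hA : ∀ i, MeasurableSet {ω | t < W i ω} := fun i => measurableSet_lt measurable_const (hm i)
  have hN : Measurable (∑ i, {ω | t < W i ω}.indicator fun _ => (1 : ℝ)) := by
    rw [Finset.sum_fn]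
    exact Finset.measurable_sum _ fun i _ => measurable_const.indicator (hA i)
  refine Integrable.of_bound (C := Real.exp (|s| * Fintype.card ι))
    (by fun_prop) (ae_of_all _ fun ω => ?_)
  rw [Real.norm_eq_abs, Real.abs_exp]
  apply Real.exp_le_exp.2
  refine (le_abs_self _).trans ?_
  rw [abs_mul]
  gcongr
  rw [Finset.sum_apply]
  refine (Finset.abs_sum_le_sum_abs _ _).trans ?_
  refine (Finset.sum_le_card_nsmul _ _ 1 fun i _ => ?_).trans (by simp)
  by_cases h : t < W i ω <;> simp [h]

lemma count_upper_tail {W : ι → Ω → ℝ} (hW : iIndepFun W P) (hm : ∀ i, Measurable (W i))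
    (t x : ℝ) {l : ℝ} (hl : 0 ≤ l) :
    P.real {ω | x ≤ ∑ i, {ω | t < W i ω}.indicator (fun _ => (1 : ℝ)) ω} ≤
      Real.exp (-l * x + (Real.exp l - 1) * ∑ i, P.real {ω | t < W i ω}) := by
  have := hW.isProbabilityMeasure
  have h := measure_ge_le_exp_mul_mgf x hl (integrable_exp_count (P := P) hm t l)
  simp only [Finset.sum_apply] at h
  rw [Real.exp_add]
  exact h.trans (mul_le_mul_of_nonneg_left (mgf_count_le hW hm t l) (Real.exp_pos _).le)

lemma count_lower_tail {W : ι → Ω → ℝ} (hW : iIndepFun W P) (hm : ∀ i, Measurable (W i))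
    (t x : ℝ) {l : ℝ} (hl : 0 ≤ l) :
    P.real {ω | ∑ i, {ω | t < W i ω}.indicator (fun _ => (1 : ℝ)) ω ≤ x} ≤
      Real.exp (l * x + (Real.exp (-l) - 1) * ∑ i, P.real {ω | t < W i ω}) := by
  have := hW.isProbabilityMeasure
  have h := measure_le_le_exp_mul_mgf x (neg_nonpos.2 hl) (integrable_exp_count (P := P) hm t (-l))
  simp only [Finset.sum_apply, neg_neg] at h
  rw [Real.exp_add]
  exact h.trans (mul_le_mul_of_nonneg_left (mgf_count_le hW hm t (-l)) (Real.exp_pos _).le)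

end Count

/-- A normalized sum of independent unit-variance Gaussians has unit variance. -/
lemma hasLaw_normalized_sum {Ω ι : Type*} [MeasurableSpace Ω] {P : Measure Ω}
    {W : ι → Ω → ℝ} {m : ι → ℝ} (hW : iIndepFun W P)
    (hm : ∀ i, Measurable (W i)) (hlaw : ∀ i, P.map (W i) = gaussianReal (m i) 1)
    {S : Finset ι} (hS : S.Nonempty) :
    HasLaw (fun ω => (∑ i ∈ S, W i ω) / √(S.card : ℝ))
      (gaussianReal ((∑ i ∈ S, m i) / √(S.card : ℝ)) 1) P := by
  classical
  have := hW.isProbabilityMeasure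
  have key : ∀ S : Finset ι, P.map (∑ i ∈ S, W i) = gaussianReal (∑ i ∈ S, m i) S.card := by
    intro S
    induction S using Finset.induction_on with
    | empty =>
      simp only [Finset.sum_empty, Finset.card_empty, Nat.cast_zero, gaussianReal_zero_var]
      change P.map (fun _ => (0 : ℝ)) = _
      rw [Measure.map_const]
      simp
    | insert a s ha ih =>
      rw [Finset.sum_insert ha, Finset.sum_insert ha, Finset.card_insert_of_notMem ha, add_comm,
        add_comm (m a)]
      have := gaussianReal_add_gaussianReal_of_indepFun
        (hW.indepFun_finsetSum_of_notMem hm ha) ih (hlaw a)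
      rw [this]
      congr 1
      push_cast
      rfl
  have h1 : HasLaw (fun ω => ∑ i ∈ S, W i ω) (gaussianReal (∑ i ∈ S, m i) S.card) P := by
    refine ⟨by fun_prop, ?_⟩
    rw [← key S]
    congr 1
    ext ω
    simp
  have h2 := gaussianReal_div_const h1 (√(S.card : ℝ))
  convert h2 using 2
  ext
  have : (S.card : ℝ) ≠ 0 := by exact_mod_cast hS.card_pos.ne'
  simp [this]

section Model

variable {d₁ d₂ : ℕ} (X : Fin d₁ → Fin d₂ → ℝ)

instance : IsProbabilityMeasure (Pmeas d₁ d₂ X) := by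
  unfold Pmeas
  infer_instance

lemma hasLaw_entry (i : Fin d₁) (j : Fin d₂) :
    HasLaw (fun y : Fin d₁ → Fin d₂ → ℝ => y i j) (gaussianReal (X i j) 1) (Pmeas d₁ d₂ X) := by
  have h1 : HasLaw (fun y : Fin d₁ → Fin d₂ → ℝ => y i)
      (Measure.pi fun j => gaussianReal (X i j) 1) (Pmeas d₁ d₂ X) :=
    (measurePreserving_eval (fun i => Measure.pi fun j => gaussianReal (X i j) 1) i).hasLaw
  have h2 : HasLaw (fun y : Fin d₂ → ℝ => y j) (gaussianReal (X i j) 1)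
      (Measure.pi fun j => gaussianReal (X i j) 1) :=
    (measurePreserving_eval (fun j => gaussianReal (X i j) 1) j).hasLaw
  exact h2.fun_comp h1

lemma iIndepFun_entries :
    iIndepFun (fun (q : Fin d₁ × Fin d₂) (y : Fin d₁ → Fin d₂ → ℝ) => y q.1 q.2)
      (Pmeas d₁ d₂ X) := by
  have h := iIndepFun_uncurry_infinitePi' (X := fun (_ : Fin d₁) (_ : Fin d₂) (x : ℝ) => x)
    (fun i j => gaussianReal (X i j) 1) (fun _ _ => measurable_id)
  simp only [Measure.infinitePi_eq_pi] at h
  exact h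

lemma iIndepFun_rows {g : (Fin d₂ → ℝ) → ℝ} (hg : Measurable g) :
    iIndepFun (fun (i : Fin d₁) (y : Fin d₁ → Fin d₂ → ℝ) => g (y i)) (Pmeas d₁ d₂ X) :=
  iIndepFun_pi (fun _ => hg.aemeasurable)

lemma map_uncurry_Pmeas :
    (Pmeas d₁ d₂ X).map (fun y (q : Fin d₁ × Fin d₂) => y q.1 q.2) =
      Measure.pi fun q : Fin d₁ × Fin d₂ => gaussianReal (X q.1 q.2) 1 := by
  refine ((iIndepFun_iff_map_fun_eq_pi_map fun q : Fin d₁ × Fin d₂ =>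
    (hasLaw_entry X q.1 q.2).aemeasurable).1 (iIndepFun_entries X)).trans ?_
  congr 1
  ext1 q
  exact (hasLaw_entry X q.1 q.2).map_eq

lemma map_transpose_Pmeas :
    (Pmeas d₁ d₂ X).map (fun y j i => y i j) = Pmeas d₂ d₁ (fun j i => X i j) := by
  have hc : Measurable (fun (z : Fin d₂ × Fin d₁ → ℝ) (j : Fin d₂) (i : Fin d₁) => z (j, i)) := by
    fun_prop
  have h1 : (Pmeas d₁ d₂ X).map (fun y (q : Fin d₂ × Fin d₁) => y q.2 q.1) =
      Measure.pi fun q : Fin d₂ × Fin d₁ => gaussianReal (X q.2 q.1) 1 := by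
    have h := (iIndepFun_entries X).precomp (g := fun q : Fin d₂ × Fin d₁ => (q.2, q.1))
      Prod.swap_injective
    refine ((iIndepFun_iff_map_fun_eq_pi_map fun q : Fin d₂ × Fin d₁ =>
      (hasLaw_entry X q.2 q.1).aemeasurable).1 h).trans ?_
    congr 1
    ext1 q
    exact (hasLaw_entry X q.2 q.1).map_eq
  have h2 := map_uncurry_Pmeas (fun j i => X i j)
  have h3 := congrArg (Measure.map
    (fun (z : Fin d₂ × Fin d₁ → ℝ) (j : Fin d₂) (i : Fin d₁) => z (j, i))) (h1.trans h2.symm)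
  rw [Measure.map_map hc (by fun_prop), Measure.map_map hc (by fun_prop)] at h3
  refine h3.trans ?_
  exact Measure.map_id

lemma hasLaw_block_sum {S : Finset (Fin d₁)} {T : Finset (Fin d₂)} (hS : S.Nonempty)
    (hT : T.Nonempty) :
    HasLaw (fun y : Fin d₁ → Fin d₂ → ℝ =>
        (∑ i ∈ S, ∑ j ∈ T, y i j) / √((S.card : ℝ) * T.card))
      (gaussianReal ((∑ i ∈ S, ∑ j ∈ T, X i j) / √((S.card : ℝ) * T.card)) 1)
      (Pmeas d₁ d₂ X) := by
  have h := hasLaw_normalized_sum (iIndepFun_entries X) (fun q => by fun_prop)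
    (fun q => (hasLaw_entry X q.1 q.2).map_eq) (hS.product hT)
  simpa only [Finset.sum_product, Finset.card_product, Nat.cast_mul] using h

lemma hasLaw_row_sum (i : Fin d₁) {T : Finset (Fin d₂)} (hT : T.Nonempty) :
    HasLaw (fun y : Fin d₁ → Fin d₂ → ℝ => (∑ j ∈ T, y i j) / √(T.card : ℝ))
      (gaussianReal ((∑ j ∈ T, X i j) / √(T.card : ℝ)) 1) (Pmeas d₁ d₂ X) := by
  simpa using hasLaw_block_sum X (Finset.singleton_nonempty i) hT

end Model

section Tests

/-- The logarithmic cost of scanning all `k`-subsets of an `n`-set. -/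
noncomputable def scanCost (n k : ℕ) : ℝ := Real.log (Real.exp 1 * (n.choose k : ℝ))

lemma exp_scanCost {n k : ℕ} (h : k ≤ n) :
    Real.exp (scanCost n k) = Real.exp 1 * (n.choose k : ℝ) := by
  have : (0 : ℝ) < n.choose k := by exact_mod_cast Nat.choose_pos h
  exact Real.exp_log (by positivity)

lemma one_le_scanCost {n k : ℕ} (h : k ≤ n) : 1 ≤ scanCost n k := by
  have : (1 : ℝ) ≤ n.choose k := by exact_mod_cast Nat.choose_pos h
  rw [← Real.exp_le_exp, exp_scanCost h]
  nlinarith [Real.exp_pos 1]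

lemma one_le_scanCost_card {n : ℕ} (T : Finset (Fin n)) : 1 ≤ scanCost n T.card :=
  one_le_scanCost (by simpa using T.card_le_univ)

lemma scanCost_self (n : ℕ) : scanCost n n = 1 := by simp [scanCost]

lemma le_choose_of_pos_of_lt {n k : ℕ} (h0 : 0 < k) (hk : k < n) : n ≤ n.choose k := by
  induction n generalizing k with
  | zero => omega
  | succ n ih =>
    obtain ⟨k, rfl⟩ := Nat.exists_eq_add_of_lt h0
    simp only [zero_add] at hk ⊢
    rw [Nat.choose_succ_succ]
    rcases Nat.lt_or_ge (k + 1) n with h | h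
    · have : n ≤ n.choose (k + 1) := ih (Nat.succ_pos k) h
      have := Nat.choose_pos (n := n) (k := k) (by omega)
      change n + 1 ≤ n.choose k + n.choose (k + 1)
      omega
    · obtain rfl : n = k + 1 := by omega
      simp [Nat.choose_succ_self_right]

/-- The family of nonempty subsets to be scanned. -/
def scanSets (n : ℕ) : Finset (Finset (Fin n)) := Finset.univ.filter Finset.Nonempty

lemma mem_scanSets {n : ℕ} {T : Finset (Fin n)} : T ∈ scanSets n ↔ T.Nonempty := by
  simp [scanSets]

lemma sum_exp_neg_two_scanCost_le (n : ℕ) :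
    ∑ T ∈ scanSets n, Real.exp (-2 * scanCost n T.card) ≤ 1 := by
  have hf : ∑ T ∈ scanSets n, Real.exp (-2 * scanCost n T.card) =
      ∑ T ∈ (Finset.univ : Finset (Fin n)).powerset,
        (fun k => if k = 0 then 0 else Real.exp (-2 * scanCost n k)) T.card := by
    rw [Finset.powerset_univ, scanSets, Finset.sum_filter]
    refine Finset.sum_congr rfl fun T _ => ?_
    by_cases h : T.Nonempty
    · simp [h, h.ne_empty]
    · simp [Finset.not_nonempty_iff_eq_empty.1 h]
  rw [hf, Finset.sum_powerset_apply_card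
    (fun k => if k = 0 then 0 else Real.exp (-2 * scanCost n k))]
  simp only [Finset.card_univ, Fintype.card_fin, nsmul_eq_mul]
  have he : Real.exp (-2) ≤ 1 / 4 := by
    have h : (2 : ℝ) ≤ Real.exp 1 := by linarith [Real.add_one_le_exp (1 : ℝ)]
    have h2 : Real.exp 2 = Real.exp 1 * Real.exp 1 := by rw [← Real.exp_add]; norm_num
    rw [Real.exp_neg, h2, ← one_div]
    apply one_div_le_one_div_of_le (by norm_num)
    nlinarith
  have hterm : ∀ k ∈ Finset.range (n + 1), (n.choose k : ℝ) *
      (if k = 0 then 0 else Real.exp (-2 * scanCost n k)) ≤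
      1 / 4 * ((if k = n then 1 else 0) + 1 / (n + 1)) * 2 := by
    intro k hk
    have hkn : k ≤ n := by simpa [Nat.lt_succ_iff] using hk
    rcases Nat.eq_zero_or_pos k with rfl | hk0
    · simp; positivity
    have hc : (0 : ℝ) < n.choose k := by exact_mod_cast Nat.choose_pos hkn
    have h1 : (n.choose k : ℝ) * Real.exp (-2 * scanCost n k) =
        Real.exp (-2) / n.choose k := by
      rw [show -2 * scanCost n k = -(scanCost n k + scanCost n k) by ring, Real.exp_neg,
        Real.exp_add, exp_scanCost hkn, Real.exp_neg,
        show (2 : ℝ) = 1 + 1 by norm_num, Real.exp_add]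
      field_simp
    rw [if_neg hk0.ne', h1]
    have hn : (0 : ℝ) < n + 1 := by positivity
    rcases hkn.eq_or_lt with rfl | hlt
    · simp only [Nat.choose_self, if_true]
      have : (0 : ℝ) < ((k : ℝ) + 1)⁻¹ := by positivity
      norm_num
      linarith
    · have h2 : ((n : ℝ) + 1) / 2 ≤ n.choose k := by
        have h3 : (n : ℝ) ≤ n.choose k := by exact_mod_cast le_choose_of_pos_of_lt hk0 hlt
        have h4 : (1 : ℝ) ≤ n := by exact_mod_cast (by omega : 1 ≤ n)
        linarith
      rw [if_neg hlt.ne]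
      calc Real.exp (-2) / n.choose k ≤ (1 / 4) / (((n : ℝ) + 1) / 2) := by gcongr
        _ = _ := by field_simp; ring
  refine (Finset.sum_le_sum hterm).trans ?_
  rw [← Finset.sum_mul, ← Finset.mul_sum, Finset.sum_add_distrib]
  simp only [Finset.sum_ite_eq', Finset.mem_range, Nat.lt_succ_self, if_true, Finset.sum_const,
    Finset.card_range, nsmul_eq_mul]
  have hn : ((n : ℝ) + 1) ≠ 0 := by positivity
  push_cast
  rw [mul_one_div_cancel hn]
  norm_num

lemma sum_exp_neg_scanCost_le (n : ℕ) {κ : ℝ} (hκ : 2 ≤ κ) :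
    ∑ T ∈ scanSets n, Real.exp (-κ * scanCost n T.card) ≤ Real.exp (-(κ - 2)) := by
  calc ∑ T ∈ scanSets n, Real.exp (-κ * scanCost n T.card)
      ≤ ∑ T ∈ scanSets n, Real.exp (-(κ - 2)) * Real.exp (-2 * scanCost n T.card) := by
        refine Finset.sum_le_sum fun T _ => ?_
        rw [← Real.exp_add]
        apply Real.exp_le_exp.2
        nlinarith [one_le_scanCost_card T]
    _ ≤ Real.exp (-(κ - 2)) := by
        rw [← Finset.mul_sum]
        exact mul_le_of_le_one_right (Real.exp_pos _).le (sum_exp_neg_two_scanCost_le n)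

/-- Rejection region of the test scanning all block sums. -/
def sumRegion (κ : ℝ) (d₁ d₂ : ℕ) : Set (Fin d₁ → Fin d₂ → ℝ) :=
  ⋃ q ∈ scanSets d₁ ×ˢ scanSets d₂,
    {y | √(2 * κ * (scanCost d₁ q.1.card + scanCost d₂ q.2.card)) ≤
      (∑ i ∈ q.1, ∑ j ∈ q.2, y i j) / √((q.1.card : ℝ) * q.2.card)}

/-- Entry-level threshold at resolution `k`. -/
noncomputable def countThreshold (B : ℝ) (k : ℕ) : ℝ := √(2 * B * (k + 1))

/-- Null probability of exceeding the threshold at resolution `k`. -/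
noncomputable def countProb (B : ℝ) (k : ℕ) : ℝ :=
  (gaussianReal 0 1).real {x | countThreshold B k < x}

/-- Number of active rows targeted at resolution `k` when the scan cost is `L`. -/
noncomputable def countScale (d₁ : ℕ) (L : ℝ) (k : ℕ) : ℝ := √(d₁ * L) / 2 ^ k

/-- The number of rows whose normalized sum over the columns in `T` exceeds `t`. -/
noncomputable def exceedCount {d₁ d₂ : ℕ} (T : Finset (Fin d₂)) (t : ℝ)
    (y : Fin d₁ → Fin d₂ → ℝ) : ℝ :=
  ∑ i, {y : Fin d₁ → Fin d₂ → ℝ | t < (∑ j ∈ T, y i j) / √(T.card : ℝ)}.indicator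
    (fun _ => (1 : ℝ)) y

/-- Rejection region of the test scanning all column sets and counting the rows with a large
normalized sum. -/
def countRegion (κ B : ℝ) (d₁ d₂ : ℕ) : Set (Fin d₁ → Fin d₂ → ℝ) :=
  ⋃ T ∈ scanSets d₂, ⋃ k ∈ Finset.range d₁,
    {y | 16 * κ * scanCost d₂ T.card ≤ countScale d₁ (scanCost d₂ T.card) k ∧
      d₁ * countProb B k + countScale d₁ (scanCost d₂ T.card) k / 8 ≤
        exceedCount T (countThreshold B k) y}

lemma measurable_exceedCount {d₁ d₂ : ℕ} (T : Finset (Fin d₂)) (t : ℝ) :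
    Measurable (exceedCount (d₁ := d₁) T t) := by
  refine Finset.measurable_sum _ fun i _ => measurable_const.indicator ?_
  exact measurableSet_lt measurable_const (by fun_prop)

lemma measurableSet_sumRegion (κ : ℝ) (d₁ d₂ : ℕ) : MeasurableSet (sumRegion κ d₁ d₂) := by
  refine Finset.measurableSet_biUnion _ fun q _ => ?_
  exact measurableSet_le measurable_const (by fun_prop)

lemma measurableSet_countRegion (κ B : ℝ) (d₁ d₂ : ℕ) :
    MeasurableSet (countRegion κ B d₁ d₂) := by
  refine Finset.measurableSet_biUnion _ fun T _ => Finset.measurableSet_biUnion _ fun k _ => ?_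
  exact (MeasurableSet.const _).inter
    (measurableSet_le measurable_const (measurable_exceedCount _ _))

lemma sumRegion_null_le {κ : ℝ} (hκ : 2 ≤ κ) (d₁ d₂ : ℕ) :
    (Pmeas d₁ d₂ 0).real (sumRegion κ d₁ d₂) ≤ Real.exp (-(κ - 2)) := by
  refine (measureReal_biUnion_finset_le _ _).trans ?_
  calc _ ≤ ∑ q ∈ scanSets d₁ ×ˢ scanSets d₂,
        Real.exp (-κ * scanCost d₁ q.1.card) * Real.exp (-κ * scanCost d₂ q.2.card) := by
        refine Finset.sum_le_sum fun q hq => ?_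
        rw [Finset.mem_product, mem_scanSets, mem_scanSets] at hq
        have h := hasLaw_block_sum (0 : Fin d₁ → Fin d₂ → ℝ) hq.1 hq.2
        have h0 : 0 ≤ 2 * κ * (scanCost d₁ q.1.card + scanCost d₂ q.2.card) := by
          have := one_le_scanCost_card q.1
          have := one_le_scanCost_card q.2
          positivity
        rw [h.measureReal_eq (p := fun x =>
          √(2 * κ * (scanCost d₁ q.1.card + scanCost d₂ q.2.card)) ≤ x) measurableSet_Ici]
        refine (gaussian_upper_tail (by simp)).trans ?_
        rw [← Real.exp_add]
        apply Real.exp_le_exp.2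
        simp only [Pi.zero_apply, Finset.sum_const_zero, zero_div, sub_zero]
        rw [Real.sq_sqrt h0]
        linarith
    _ = (∑ S ∈ scanSets d₁, Real.exp (-κ * scanCost d₁ S.card)) *
        ∑ T ∈ scanSets d₂, Real.exp (-κ * scanCost d₂ T.card) := by
        rw [Finset.sum_mul_sum, Finset.sum_product]
    _ ≤ Real.exp (-(κ - 2)) * 1 := by
        refine mul_le_mul (sum_exp_neg_scanCost_le _ hκ) ?_
          (Finset.sum_nonneg fun _ _ => (Real.exp_pos _).le) (Real.exp_pos _).le
        exact (sum_exp_neg_scanCost_le _ hκ).trans (Real.exp_le_one_iff.2 (by linarith))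
    _ = _ := mul_one _

lemma countProb_nonneg (B : ℝ) (k : ℕ) : 0 ≤ countProb B k := measureReal_nonneg

lemma countProb_le {B : ℝ} (hB : 0 ≤ B) (k : ℕ) :
    countProb B k ≤ Real.exp (-(B * (k + 1))) := by
  have h := gaussian_upper_tail (m := 0) (t := countThreshold B k) (Real.sqrt_nonneg _)
  refine (measureReal_mono fun x (hx : _ < x) => (hx.le : _ ≤ x)).trans (h.trans ?_)
  apply Real.exp_le_exp.2
  rw [sub_zero, countThreshold, Real.sq_sqrt (by positivity)]
  linarith

lemma four_pow_le_exp (k : ℕ) : (4 : ℝ) ^ k ≤ Real.exp (2 * (k + 1)) := by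
  have h : (4 : ℝ) ≤ Real.exp 2 := by
    have h : (2 : ℝ) ≤ Real.exp 1 := by linarith [Real.add_one_le_exp (1 : ℝ)]
    have h2 : Real.exp 2 = Real.exp 1 * Real.exp 1 := by rw [← Real.exp_add]; norm_num
    nlinarith
  calc (4 : ℝ) ^ k ≤ Real.exp 2 ^ k := by gcongr
    _ = Real.exp (k * 2) := by rw [Real.exp_nat_mul]
    _ ≤ _ := Real.exp_le_exp.2 (by linarith)

/-- Expected number of null exceedances is small relative to the square of the scale. -/
lemma mul_countProb_le {B L : ℝ} (hB : 0 ≤ B) (hL : 0 < L) (d₁ k : ℕ) :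
    d₁ * countProb B k ≤ countScale d₁ L k ^ 2 / L * Real.exp (-((B - 2) * (k + 1))) := by
  have h4 : countScale d₁ L k ^ 2 / L = d₁ / 4 ^ k := by
    rw [countScale, div_pow, Real.sq_sqrt (by positivity), ← pow_mul, mul_comm k 2, pow_mul]
    norm_num
    field_simp
  rw [h4, show -((B - 2) * ((k : ℝ) + 1)) = -(B * (k + 1)) + 2 * (k + 1) by ring, Real.exp_add]
  calc (d₁ : ℝ) * countProb B k ≤ d₁ * Real.exp (-(B * (k + 1))) := by
        gcongr
        exact countProb_le hB k
    _ = d₁ / 4 ^ k * (Real.exp (-(B * (k + 1))) * 4 ^ k) := by field_simp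
    _ ≤ _ := by
        gcongr
        exact four_pow_le_exp k

lemma exp_sub_one_sub_le {l : ℝ} (hl : 0 ≤ l) :
    Real.exp l - 1 - l ≤ l ^ 2 * Real.exp l := by
  have h1 : Real.exp l - 1 ≤ l * Real.exp l := by
    have h := Real.add_one_le_exp (-l)
    have h2 : Real.exp (-l) * Real.exp l = 1 := by rw [← Real.exp_add]; simp
    nlinarith [Real.exp_pos l]
  nlinarith

lemma count_null_exponent_le {κ B L : ℝ} (hκ : 1 ≤ κ) (hB : 4 ≤ B)
    (hκB : 256 * κ ≤ Real.exp (B - 4)) (hL : 1 ≤ L) {d₁ k : ℕ}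
    (hb : 16 * κ * L ≤ countScale d₁ L k) :
    -(16 * κ * L * (k + 1) / countScale d₁ L k) *
        (d₁ * countProb B k + countScale d₁ L k / 8) +
      (Real.exp (16 * κ * L * (k + 1) / countScale d₁ L k) - 1) * (d₁ * countProb B k) ≤
    -(κ * L * (k + 1)) := by
  set b := countScale d₁ L k
  set l := 16 * κ * L * (k + 1) / b with hl
  have hb0 : 0 < b := lt_of_lt_of_le (by positivity) hb
  have hl0 : 0 ≤ l := by positivity
  have hl1 : l ≤ k + 1 := by
    rw [hl, div_le_iff₀ hb0]
    nlinarith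
  have hp := mul_countProb_le (B := B) (by linarith) (by linarith : 0 < L) d₁ k
  have hlb : l * b = 16 * κ * L * (k + 1) := by
    rw [hl]
    field_simp
  have hk1 : ((k : ℝ) + 1) ≤ Real.exp (k + 1) := by linarith [Real.add_one_le_exp ((k : ℝ) + 1)]
  have hmain : d₁ * countProb B k * (Real.exp l - 1 - l) ≤ κ * L * (k + 1) := by
    calc d₁ * countProb B k * (Real.exp l - 1 - l)
        ≤ (b ^ 2 / L * Real.exp (-((B - 2) * (k + 1)))) * (l ^ 2 * Real.exp (k + 1)) := by
          refine (mul_le_mul_of_nonneg_left (exp_sub_one_sub_le hl0)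
            (mul_nonneg (Nat.cast_nonneg _) (countProb_nonneg B k))).trans ?_
          gcongr
      _ = (l * b) ^ 2 / L * Real.exp (-((B - 3) * (k + 1))) := by
          have he : Real.exp (-((B - 3) * ((k : ℝ) + 1))) =
              Real.exp (-((B - 2) * (k + 1))) * Real.exp (k + 1) := by
            rw [← Real.exp_add]
            ring_nf
          rw [he]
          ring
      _ = κ * L * (k + 1) * (256 * κ * ((k + 1) * Real.exp (-((B - 3) * (k + 1))))) := by
          rw [hlb]
          field_simp
          ring
      _ ≤ κ * L * (k + 1) * (256 * κ * Real.exp (-(B - 4))) := by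
          gcongr
          calc ((k : ℝ) + 1) * Real.exp (-((B - 3) * (k + 1)))
              ≤ Real.exp (k + 1) * Real.exp (-((B - 3) * (k + 1))) := by gcongr
            _ = Real.exp (-((B - 4) * (k + 1))) := by rw [← Real.exp_add]; ring_nf
            _ ≤ _ := by
              apply Real.exp_le_exp.2
              nlinarith [(Nat.cast_nonneg k : (0 : ℝ) ≤ k)]
      _ ≤ κ * L * (k + 1) * 1 := by
          gcongr
          rw [Real.exp_neg, ← div_eq_mul_inv]
          exact (div_le_one (Real.exp_pos _)).2 hκB
      _ = _ := mul_one _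
  nlinarith

lemma countRegion_null_le {κ B : ℝ} (hκ : 2 ≤ κ) (hB : 4 ≤ B)
    (hκB : 256 * κ ≤ Real.exp (B - 4)) (d₁ d₂ : ℕ) :
    (Pmeas d₁ d₂ 0).real (countRegion κ B d₁ d₂) ≤ 2 * Real.exp (-(κ - 2)) := by
  have hterm : ∀ T ∈ scanSets d₂, ∀ k : ℕ, (Pmeas d₁ d₂ 0).real
      {y | 16 * κ * scanCost d₂ T.card ≤ countScale d₁ (scanCost d₂ T.card) k ∧
      d₁ * countProb B k + countScale d₁ (scanCost d₂ T.card) k / 8 ≤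
        exceedCount T (countThreshold B k) y} ≤
      Real.exp (-κ * scanCost d₂ T.card) * (1 / 2) ^ k := by
    intro T hT k
    have hL := one_le_scanCost_card T
    set L := scanCost d₂ T.card
    by_cases hb : 16 * κ * L ≤ countScale d₁ L k
    swap
    · simp only [hb, false_and, Set.ofPred_false, measureReal_empty]
      positivity
    simp only [hb, true_and]
    have hb0 : 0 < countScale d₁ L k := lt_of_lt_of_le (by positivity) hb
    have hlaw := fun i => hasLaw_row_sum (0 : Fin d₁ → Fin d₂ → ℝ) i (mem_scanSets.1 hT)
    have h := count_upper_tail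
      (iIndepFun_rows (0 : Fin d₁ → Fin d₂ → ℝ)
        (g := fun x => (∑ j ∈ T, x j) / √(T.card : ℝ)) (by fun_prop))
      (fun i => by fun_prop) (countThreshold B k)
      (d₁ * countProb B k + countScale d₁ L k / 8)
      (l := 16 * κ * L * (k + 1) / countScale d₁ L k) (by positivity)
    have hsum : ∑ i : Fin d₁, (Pmeas d₁ d₂ 0).real
        {y | countThreshold B k < (∑ j ∈ T, y i j) / √(T.card : ℝ)} = d₁ * countProb B k := by
      rw [Finset.sum_congr rfl fun i _ => (hlaw i).measureReal_eq
        (p := fun x => countThreshold B k < x) measurableSet_Ioi]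
      simp [countProb]
    rw [hsum] at h
    refine h.trans ((Real.exp_le_exp.2
      (count_null_exponent_le (by linarith) hB hκB hL hb)).trans ?_)
    rw [show -(κ * L * ((k : ℝ) + 1)) = -κ * L + k * (-(κ * L)) by ring, Real.exp_add,
      Real.exp_nat_mul]
    gcongr
    calc Real.exp (-(κ * L)) ≤ Real.exp (-1) := Real.exp_le_exp.2 (by nlinarith)
      _ ≤ 1 / 2 := by
        rw [Real.exp_neg, ← one_div]
        exact one_div_le_one_div_of_le (by norm_num) (by linarith [Real.add_one_le_exp (1 : ℝ)])
  refine (measureReal_biUnion_finset_le _ _).trans ?_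
  calc _ ≤ ∑ T ∈ scanSets d₂, Real.exp (-κ * scanCost d₂ T.card) * 2 := by
        refine Finset.sum_le_sum fun T hT => (measureReal_biUnion_finset_le _ _).trans ?_
        refine (Finset.sum_le_sum fun k _ => hterm T hT k).trans ?_
        rw [← Finset.mul_sum]
        gcongr
        exact sum_geometric_two_le d₁
    _ ≤ 2 * Real.exp (-(κ - 2)) := by
        rw [← Finset.sum_mul, mul_comm]
        gcongr
        exact sum_exp_neg_scanCost_le _ hκ

end Tests

section Power

variable {d₁ d₂ : ℕ} {X : Fin d₁ → Fin d₂ → ℝ}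

lemma sumRegion_compl_le {κ M : ℝ} (hκ : 1 ≤ κ) {S : Finset (Fin d₁)} {T : Finset (Fin d₂)}
    (hS : S.Nonempty) (hT : T.Nonempty) (hM0 : 0 ≤ M)
    (hM : M ≤ (∑ i ∈ S, ∑ j ∈ T, X i j) / √((S.card : ℝ) * T.card))
    (hM2 : 8 * κ * (scanCost d₁ S.card + scanCost d₂ T.card) ≤ M ^ 2) :
    (Pmeas d₁ d₂ X).real (sumRegion κ d₁ d₂)ᶜ ≤ Real.exp (-κ) := by
  have hL1 := one_le_scanCost_card S
  have hL2 := one_le_scanCost_card T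
  set L := scanCost d₁ S.card + scanCost d₂ T.card with hL
  have hL0 : 0 ≤ 2 * κ * L := by positivity
  have hτ : 2 * √(2 * κ * L) ≤ M := by
    rw [← sq_le_sq₀ (by positivity) hM0]
    rw [mul_pow, Real.sq_sqrt hL0]
    linarith
  have hlaw := hasLaw_block_sum X hS hT
  have hsub : (sumRegion κ d₁ d₂)ᶜ ⊆
      {y | (∑ i ∈ S, ∑ j ∈ T, y i j) / √((S.card : ℝ) * T.card) ≤ √(2 * κ * L)} := by
    intro y hy
    by_contra hlt
    rw [Set.mem_ofPred_eq, not_le] at hlt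
    refine hy (Set.mem_iUnion₂.2 ⟨(S, T), ?_, hlt.le⟩)
    simp [mem_scanSets, hS, hT]
  refine (measureReal_mono hsub).trans ?_
  have h0 := Real.sqrt_nonneg (2 * κ * L)
  rw [hlaw.measureReal_eq (p := fun x => x ≤ √(2 * κ * L)) measurableSet_Iic]
  refine (gaussian_lower_tail (by linarith)).trans (Real.exp_le_exp.2 ?_)
  have h1 : √(2 * κ * L) ≤
      (∑ i ∈ S, ∑ j ∈ T, X i j) / √((S.card : ℝ) * T.card) - √(2 * κ * L) := by linarith
  have h2 := pow_le_pow_left₀ h0 h1 2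
  rw [Real.sq_sqrt hL0] at h2
  nlinarith

lemma exists_resolution {a r : ℝ} (ha : 0 < a) (har : a < r) :
    ∃ k : ℕ, 1 ≤ k ∧ r / 2 ^ k ≤ a ∧ a < 2 * (r / 2 ^ k) := by
  have hex : ∃ k : ℕ, r ≤ a * 2 ^ k := by
    obtain ⟨k, hk⟩ := pow_unbounded_of_one_lt (r / a) (one_lt_two)
    exact ⟨k, by rw [div_lt_iff₀ ha] at hk; linarith⟩
  classical
  have hk := Nat.find_spec hex
  set k := Nat.find hex with hkdef
  have hk1 : 1 ≤ k := by
    by_contra h0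
    have : k = 0 := by omega
    rw [this] at hk
    simp at hk
    linarith
  refine ⟨k, hk1, by rw [div_le_iff₀ (by positivity)]; exact hk, ?_⟩
  have hmin := Nat.find_min hex (m := k - 1) (by omega)
  obtain ⟨l, hl⟩ : ∃ l, k = l + 1 := ⟨k - 1, by omega⟩
  rw [hl, Nat.add_sub_cancel] at hmin
  rw [hl, pow_succ, mul_div_assoc', lt_div_iff₀ (by positivity)]
  linarith

lemma succ_div_four_le_log {k : ℕ} (hk : 1 ≤ k) {x : ℝ} (hx : (4 : ℝ) ^ k ≤ 4 * x) :
    ((k : ℝ) + 1) / 4 ≤ Real.log (1 + x) := by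
  obtain ⟨l, rfl⟩ := Nat.exists_eq_add_of_le' hk
  have h1 : (2 : ℝ) ^ (l + 1) ≤ 1 + 4 ^ l := by
    have : (4 : ℝ) ^ l = (2 ^ l) ^ 2 := by rw [← pow_mul, mul_comm, pow_mul]; norm_num
    rw [this, pow_succ]
    nlinarith [sq_nonneg ((2 : ℝ) ^ l - 1)]
  have h2 : (2 : ℝ) ^ (l + 1) ≤ 1 + x := by
    rw [pow_succ] at hx
    linarith
  have h3 := Real.log_le_log (by positivity) h2
  rw [Real.log_pow] at h3
  have h4 := Real.log_two_gt_d9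
  push_cast at h3 ⊢
  nlinarith [(Nat.cast_nonneg l : (0 : ℝ) ≤ l)]

lemma lower_tail_exponent_le {κ a b q σ : ℝ} (hκ : 0 < κ) (ha : 32 * κ ≤ a) (hq : 0 ≤ q)
    (hqa : q * (256 * κ) ≤ a ^ 2) (hba : b ≤ a) (hσ : q + a / 2 ≤ σ) :
    8 * κ / a * (q + b / 8) + (Real.exp (-(8 * κ / a)) - 1) * σ ≤ -κ := by
  have ha0 : 0 < a := by linarith
  have hl0 : 0 ≤ 8 * κ / a := by positivity
  have hl1 : 8 * κ / a ≤ 1 / 4 := by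
    rw [div_le_iff₀ ha0]
    linarith
  have hla : 8 * κ / a * a = 8 * κ := by field_simp
  set l := 8 * κ / a
  have hexp : Real.exp (-l) - 1 ≤ -l + l ^ 2 := by
    have := Real.abs_exp_sub_one_sub_id_le (x := -l)
      (by rw [abs_neg, abs_of_nonneg hl0]; linarith)
    have := (abs_le.1 this).2
    nlinarith
  have hneg : Real.exp (-l) - 1 ≤ 0 := by
    have : Real.exp (-l) ≤ 1 := Real.exp_le_one_iff.2 (by linarith)
    linarith
  have hmain : l ^ 2 * q ≤ κ := by
    have h1 : l ^ 2 * (q * (256 * κ)) ≤ l ^ 2 * a ^ 2 := by gcongr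
    rw [← mul_pow, hla] at h1
    have h2 : κ * (l ^ 2 * q) ≤ κ * κ := by nlinarith
    exact le_of_mul_le_mul_left h2 hκ
  have hmain2 : l ^ 2 * (a / 2) ≤ κ := by
    have h1 : l ^ 2 * (a / 2) = l * (4 * κ) := by linear_combination (l / 2) * hla
    rw [h1]
    nlinarith
  have hs1 := mul_le_mul_of_nonpos_left hσ hneg
  have hs2 := mul_le_mul_of_nonneg_right hexp (show 0 ≤ q + a / 2 by positivity)
  have hs3 : l * (b / 8) ≤ l * (a / 8) := by gcongr
  nlinarith

lemma countRegion_compl_le {κ B C v : ℝ} (hκ : 1 ≤ κ) (hB : 4 ≤ B)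
    (hκB : 256 * κ ≤ Real.exp (B - 4)) (hC : 32 * B ≤ C)
    {T : Finset (Fin d₂)} (hT : T.Nonempty) {A : Finset (Fin d₁)}
    (hX : ∀ i, 0 ≤ ∑ j ∈ T, X i j) (hv0 : 0 ≤ v)
    (hv : ∀ i ∈ A, v ≤ (∑ j ∈ T, X i j) / √(T.card : ℝ))
    (hA : 32 * κ * scanCost d₂ T.card ≤ A.card)
    (hlt : (A.card : ℝ) ^ 2 < d₁ * scanCost d₂ T.card)
    (hvC : C * Real.log (1 + d₁ * scanCost d₂ T.card / (A.card : ℝ) ^ 2) ≤ v ^ 2) :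
    (Pmeas d₁ d₂ X).real (countRegion κ B d₁ d₂)ᶜ ≤ Real.exp (-κ) := by
  have hL := one_le_scanCost_card T
  set L := scanCost d₂ T.card with hLdef
  set a : ℝ := (A.card : ℝ) with ha
  have ha32 : 32 * κ ≤ a := by nlinarith
  have ha0 : 0 < a := by linarith
  have har : a < √(d₁ * L) := Real.lt_sqrt_of_sq_lt hlt
  obtain ⟨k, hk1, hka, hak⟩ := exists_resolution ha0 har
  have hbdef : √(d₁ * L) / 2 ^ k = countScale d₁ L k := rfl
  rw [hbdef] at hka hak
  set b := countScale d₁ L k with hb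
  have hb16 : 16 * κ * L ≤ b := by linarith
  have hb0 : 0 < b := by linarith
  have hb2 : b ^ 2 * 4 ^ k = d₁ * L := by
    rw [hb, countScale, div_pow, Real.sq_sqrt (by positivity), ← pow_mul, mul_comm k 2, pow_mul]
    norm_num
  have hkd : k < d₁ := by
    have h1 : L ≤ b ^ 2 := by nlinarith
    have h2 : (4 : ℝ) ^ k ≤ d₁ := by
      have : L * 4 ^ k ≤ L * d₁ := by
        calc L * 4 ^ k ≤ b ^ 2 * 4 ^ k := by gcongr
          _ = L * d₁ := by rw [hb2, mul_comm]
      exact le_of_mul_le_mul_left this (by linarith)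
    have h3 : 4 ^ k ≤ d₁ := by exact_mod_cast h2
    exact (Nat.lt_pow_self (by norm_num)).trans_le h3
  have hlog : ((k : ℝ) + 1) / 4 ≤ Real.log (1 + d₁ * L / a ^ 2) := by
    refine succ_div_four_le_log hk1 ?_
    rw [← hb2, mul_div_assoc', le_div_iff₀ (by positivity)]
    have : a ^ 2 ≤ 4 * b ^ 2 := by nlinarith
    nlinarith [pow_pos (show (0 : ℝ) < 4 by norm_num) k]
  set t := countThreshold B k with ht
  have ht0 : 0 ≤ t := Real.sqrt_nonneg _
  have ht2 : t ^ 2 = 2 * B * (k + 1) := Real.sq_sqrt (by positivity)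
  have hvt : 2 * t ≤ v := by
    rw [← sq_le_sq₀ (by positivity) hv0]
    rw [mul_pow, ht2]
    have : 32 * B * (((k : ℝ) + 1) / 4) ≤ C * Real.log (1 + d₁ * L / a ^ 2) :=
      mul_le_mul hC hlog (by positivity) (by linarith)
    linarith
  set p := countProb B k with hp
  have hexp4 : Real.exp (-4) ≤ 1 / 4 := by
    rw [Real.exp_neg, ← one_div]
    exact one_div_le_one_div_of_le (by norm_num) (by linarith [Real.add_one_le_exp (4 : ℝ)])
  have hBk : Real.exp (-(B * (k + 1))) ≤ 1 / 4 :=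
    (Real.exp_le_exp.2 (by nlinarith [(Nat.cast_nonneg k : (0 : ℝ) ≤ k)])).trans hexp4
  have hp4 : p ≤ 1 / 4 := (countProb_le (by linarith) k).trans hBk
  have hlaw := fun i => hasLaw_row_sum X i hT
  have hpi : ∀ i, (Pmeas d₁ d₂ X).real {y | t < (∑ j ∈ T, y i j) / √(T.card : ℝ)} =
      (gaussianReal ((∑ j ∈ T, X i j) / √(T.card : ℝ)) 1).real {x | t < x} := fun i =>
    (hlaw i).measureReal_eq (p := fun x => t < x) measurableSet_Ioi
  have hsum : d₁ * p + a / 2 ≤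
      ∑ i, (Pmeas d₁ d₂ X).real {y | t < (∑ j ∈ T, y i j) / √(T.card : ℝ)} := by
    have h1 : d₁ * p + a / 2 = ∑ i : Fin d₁, (p + if i ∈ A then 1 / 2 else 0) := by
      rw [Finset.sum_add_distrib, Finset.sum_ite_mem]
      simp [ha]
      ring
    rw [h1]
    refine Finset.sum_le_sum fun i _ => ?_
    rw [hpi]
    by_cases hi : i ∈ A
    · rw [if_pos hi]
      have h2 := hv i hi
      have h3 := gaussian_lower_tail (m := (∑ j ∈ T, X i j) / √(T.card : ℝ)) (t := t)
        (by linarith)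
      have h4 : Real.exp (-((∑ j ∈ T, X i j) / √(T.card : ℝ) - t) ^ 2 / 2) ≤
          Real.exp (-(B * (k + 1))) := by
        apply Real.exp_le_exp.2
        have := pow_le_pow_left₀ ht0
          (show t ≤ (∑ j ∈ T, X i j) / √(T.card : ℝ) - t by linarith) 2
        linarith
      have h5 : (gaussianReal ((∑ j ∈ T, X i j) / √(T.card : ℝ)) 1).real {x | t < x} =
          1 - (gaussianReal ((∑ j ∈ T, X i j) / √(T.card : ℝ)) 1).real {x | x ≤ t} := by
        rw [← probReal_compl_eq_one_sub (s := {x : ℝ | x ≤ t}) measurableSet_Iic]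
        congr 1
        ext x
        simp
      linarith
    · rw [if_neg hi, add_zero]
      exact gaussian_upper_prob_mono (div_nonneg (hX i) (Real.sqrt_nonneg _))
  have hsub : (countRegion κ B d₁ d₂)ᶜ ⊆ {y | exceedCount T t y ≤ d₁ * p + b / 8} := by
    intro y hy
    by_contra hlt
    exact hy (Set.mem_biUnion (mem_scanSets.2 hT)
      (Set.mem_biUnion (Finset.mem_range.2 hkd) ⟨hb16, (not_le.1 hlt).le⟩))
  have hl0 : 0 ≤ 8 * κ / a := by positivity
  have hl1 : 8 * κ / a ≤ 1 := by
    rw [div_le_one ha0]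
    linarith
  have h := count_lower_tail
    (iIndepFun_rows X (g := fun x => (∑ j ∈ T, x j) / √(T.card : ℝ)) (by fun_prop))
    (fun i => by fun_prop) t (d₁ * p + b / 8) hl0
  refine (measureReal_mono hsub).trans (h.trans (Real.exp_le_exp.2 ?_))
  have hp0 : 0 ≤ d₁ * p := mul_nonneg (Nat.cast_nonneg _) (countProb_nonneg B k)
  have hdp : d₁ * p * (256 * κ) ≤ a ^ 2 := by
    have h1 := mul_countProb_le (B := B) (by linarith) (by linarith : 0 < L) d₁ k
    have h2 : Real.exp (-((B - 2) * ((k : ℝ) + 1))) ≤ Real.exp (-(B - 4)) :=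
      Real.exp_le_exp.2 (by nlinarith [(Nat.cast_nonneg k : (0 : ℝ) ≤ k)])
    have h3 : b ^ 2 / L ≤ a ^ 2 := by
      have hba : b ^ 2 ≤ a ^ 2 := pow_le_pow_left₀ hb0.le hka 2
      exact (div_le_self (sq_nonneg b) hL).trans hba
    have h4 : d₁ * p ≤ a ^ 2 * Real.exp (-(B - 4)) :=
      h1.trans (mul_le_mul h3 h2 (Real.exp_pos _).le (sq_nonneg a))
    calc d₁ * p * (256 * κ) ≤ a ^ 2 * Real.exp (-(B - 4)) * Real.exp (B - 4) := by gcongr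
      _ = a ^ 2 := by rw [mul_assoc, ← Real.exp_add]; simp
  exact lower_tail_exponent_le (by linarith) ha32 hp0 hdp hka hsum

/-- The combined rejection region of block sums and exceedance counts. -/
def scanRegion (κ B : ℝ) (d₁ d₂ : ℕ) : Set (Fin d₁ → Fin d₂ → ℝ) :=
  sumRegion κ d₁ d₂ ∪ countRegion κ B d₁ d₂

lemma measurableSet_scanRegion (κ B : ℝ) (d₁ d₂ : ℕ) : MeasurableSet (scanRegion κ B d₁ d₂) :=
  (measurableSet_sumRegion _ _ _).union (measurableSet_countRegion _ _ _ _)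

lemma scanRegion_null_le {κ B : ℝ} (hκ : 2 ≤ κ) (hB : 4 ≤ B)
    (hκB : 256 * κ ≤ Real.exp (B - 4)) (d₁ d₂ : ℕ) :
    (Pmeas d₁ d₂ 0).real (scanRegion κ B d₁ d₂) ≤ 3 * Real.exp (-(κ - 2)) := by
  have h1 := sumRegion_null_le hκ d₁ d₂
  have h2 := countRegion_null_le hκ hB hκB d₁ d₂
  have h3 := measureReal_union_le (μ := Pmeas d₁ d₂ 0) (sumRegion κ d₁ d₂) (countRegion κ B d₁ d₂)
  unfold scanRegion
  linarith

lemma half_le_log_one_add {x : ℝ} (h0 : 0 ≤ x) (h1 : x ≤ 1) : x / 2 ≤ Real.log (1 + x) := by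
  refine le_trans ?_ (Real.le_log_one_add_of_nonneg h0)
  rw [div_le_div_iff₀ (by norm_num) (by linarith)]
  nlinarith

lemma scanRegion_compl_le_of_rows {κ B C v : ℝ} (hκ : 1 ≤ κ) (hB : 4 ≤ B)
    (hκB : 256 * κ ≤ Real.exp (B - 4)) (hC : 32 * B ≤ C) (hCκ : 32 * κ ≤ C)
    {T : Finset (Fin d₂)} (hT : T.Nonempty) {A : Finset (Fin d₁)}
    (hX : ∀ i, 0 ≤ ∑ j ∈ T, X i j) (hv0 : 0 ≤ v)
    (hv : ∀ i ∈ A, v ≤ (∑ j ∈ T, X i j) / √(T.card : ℝ))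
    (hA : 32 * κ * scanCost d₂ T.card ≤ A.card)
    (hvC : C * Real.log (1 + d₁ * scanCost d₂ T.card / (A.card : ℝ) ^ 2) ≤ v ^ 2) :
    (Pmeas d₁ d₂ X).real (scanRegion κ B d₁ d₂)ᶜ ≤ Real.exp (-κ) := by
  have hL := one_le_scanCost_card T
  rcases lt_or_ge ((A.card : ℝ) ^ 2) (d₁ * scanCost d₂ T.card) with hlt | hge
  · exact (measureReal_mono (Set.compl_subset_compl.2 Set.subset_union_right)).trans
      (countRegion_compl_le hκ hB hκB hC hT hX hv0 hv hA hlt hvC)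
  refine (measureReal_mono (Set.compl_subset_compl.2 Set.subset_union_left)).trans ?_
  set L := scanCost d₂ T.card with hLdef
  have ha0 : (0 : ℝ) < A.card := by nlinarith
  have hd : (0 : ℝ) < d₁ := by
    have h1 : A.card ≤ d₁ := by simpa using A.card_le_univ
    have h2 : (A.card : ℝ) ≤ d₁ := by exact_mod_cast h1
    linarith
  have hAne : A.Nonempty := Finset.card_pos.1 (by exact_mod_cast ha0)
  set a : ℝ := (A.card : ℝ) with ha
  have hTc : (0 : ℝ) < T.card := by exact_mod_cast hT.card_pos
  refine sumRegion_compl_le (S := Finset.univ) (T := T) (M := a * v / √d₁) hκ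
    ⟨hAne.choose, Finset.mem_univ _⟩ hT (by positivity) ?_ ?_
  · have h1 : a * (v * √(T.card : ℝ)) ≤ ∑ i, ∑ j ∈ T, X i j := by
      calc a * (v * √(T.card : ℝ)) = ∑ i ∈ A, v * √(T.card : ℝ) := by simp [ha]
        _ ≤ ∑ i ∈ A, ∑ j ∈ T, X i j := by
          refine Finset.sum_le_sum fun i hi => ?_
          have := hv i hi
          rwa [le_div_iff₀ (by positivity)] at this
        _ ≤ ∑ i, ∑ j ∈ T, X i j :=
          Finset.sum_le_sum_of_subset_of_nonneg (Finset.subset_univ _) fun i _ _ => hX i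
    rw [Finset.card_univ, Fintype.card_fin, Real.sqrt_mul hd.le,
      div_le_div_iff₀ (by positivity) (by positivity)]
    nlinarith [Real.sqrt_nonneg (d₁ : ℝ)]
  · rw [Finset.card_univ, Fintype.card_fin, scanCost_self, div_pow, mul_pow,
      Real.sq_sqrt hd.le]
    have hx1 : d₁ * L / a ^ 2 ≤ 1 := by
      rw [div_le_one (by positivity)]
      exact hge
    have hx := half_le_log_one_add (by positivity) hx1
    have h1 : 32 * κ * (d₁ * L / a ^ 2 / 2) ≤ v ^ 2 :=
      le_trans (mul_le_mul hCκ hx (by positivity) (by linarith)) hvC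
    rw [le_div_iff₀ hd]
    have h2 : a ^ 2 * (32 * κ * (d₁ * L / a ^ 2 / 2)) ≤ a ^ 2 * v ^ 2 := by gcongr
    have h3 : a ^ 2 * (32 * κ * (d₁ * L / a ^ 2 / 2)) = 16 * κ * (d₁ * L) := by
      field_simp
      ring
    rw [h3] at h2
    have h4 : κ * d₁ * 1 ≤ κ * d₁ * L := by gcongr
    nlinarith

end Power

section Rates

lemma log_one_add_div_le {K x : ℝ} (hK : 1 ≤ K) (hx : 0 ≤ x) :
    Real.log (1 + x) / K ≤ Real.log (1 + x / K) := by
  have hK0 : 0 < K := by linarith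
  have hxK : 0 ≤ x / K := by positivity
  have h := one_add_mul_self_le_rpow_one_add (show -1 ≤ x / K by linarith) hK
  rw [mul_div_cancel₀ x hK0.ne'] at h
  have h2 := Real.log_le_log (by linarith) h
  rw [Real.log_rpow (by linarith)] at h2
  rw [div_le_iff₀ hK0]
  linarith

lemma scanCost_le {n k : ℕ} (hk : 0 < k) (hkn : k ≤ n) :
    scanCost n k ≤ 4 * (k * Real.log (1 + n / k)) := by
  have hk0 : (0 : ℝ) < k := by exact_mod_cast hk
  have hk1 : (1 : ℝ) ≤ k := by exact_mod_cast hk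
  have hkn' : (k : ℝ) ≤ n := by exact_mod_cast hkn
  have hx : 1 ≤ (n : ℝ) / k := by rwa [one_le_div hk0]
  have hC : (n.choose k : ℝ) ≤ ((1 + n / k) * Real.exp 1) ^ k := by
    calc (n.choose k : ℝ) ≤ (n : ℝ) ^ k / (k.factorial : ℝ) := Nat.choose_le_pow_div k n
      _ = (n / k : ℝ) ^ k * ((k : ℝ) ^ k / (k.factorial : ℝ)) := by
        rw [div_pow]
        field_simp
      _ ≤ (1 + n / k) ^ k * Real.exp k := by
        gcongr
        · linarith
        · exact Real.pow_div_factorial_le_exp _ hk0.le k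
      _ = ((1 + n / k) * Real.exp 1) ^ k := by
        rw [mul_pow, ← Real.exp_nat_mul, mul_one]
  have hCpos : (0 : ℝ) < n.choose k := by exact_mod_cast Nat.choose_pos hkn
  have h1 := Real.log_le_log hCpos hC
  rw [Real.log_pow, Real.log_mul (by positivity) (Real.exp_pos 1).ne', Real.log_exp] at h1
  have h2 : Real.log 2 ≤ Real.log (1 + n / k) := Real.log_le_log (by norm_num) (by linarith)
  have h3 := Real.log_two_gt_d9
  rw [scanCost, Real.log_mul (Real.exp_pos 1).ne' hCpos.ne', Real.log_exp]
  nlinarith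

lemma psi_nonneg {s₁ s₂ d₁ d₂ : ℕ} (h : s₁ ≤ d₁) : 0 ≤ psi s₁ s₂ d₁ d₂ := by
  have h1 : 0 ≤ scanCost d₁ s₁ := zero_le_one.trans (one_le_scanCost h)
  refine mul_nonneg (by positivity) (Real.log_nonneg ?_)
  have : 0 ≤ (d₂ : ℝ) / (s₂ : ℝ) ^ 2 * scanCost d₁ s₁ := by positivity
  rw [scanCost] at this
  linarith

/-- The constant multiplying the separation rate. -/
def rateConst (κ B : ℝ) : ℝ := 40000 * κ ^ 3 + 32 * B

variable {d₁ d₂ : ℕ} {X : Fin d₁ → Fin d₂ → ℝ} {κ B μ : ℝ}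
  {S : Finset (Fin d₁)} {T : Finset (Fin d₂)}

lemma scanRegion_compl_le_of_phi (hκ : 1 ≤ κ) (hB : 4 ≤ B) (hκB : 256 * κ ≤ Real.exp (B - 4))
    (hS : S.Nonempty) (hT : T.Nonempty) (hX : ∀ i j, 0 ≤ X i j) (hμ : 0 ≤ μ)
    (hμX : ∀ i j, i ∈ S → j ∈ T → μ ≤ X i j)
    (h : rateConst κ B * phi T.card S.card d₂ d₁ ≤ μ ^ 2) :
    (Pmeas d₁ d₂ X).real (scanRegion κ B d₁ d₂)ᶜ ≤ Real.exp (-κ) := by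
  have hT0 : (0 : ℝ) < T.card := by exact_mod_cast hT.card_pos
  have hS0 : (0 : ℝ) < S.card := by exact_mod_cast hS.card_pos
  obtain ⟨i₀, hi₀⟩ := hS
  obtain ⟨j₀, -⟩ := hT
  have hd₂ : (0 : ℝ) < d₂ := by exact_mod_cast j₀.pos
  have hd₁ : (1 : ℝ) ≤ d₁ := by exact_mod_cast i₀.pos
  have hκ3 : κ ≤ κ ^ 3 := le_self_pow₀ hκ (by norm_num)
  have hrow : ∀ i ∈ S, T.card * μ ≤ ∑ j, X i j := fun i hi => by
    calc T.card * μ = ∑ j ∈ T, μ := by simp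
      _ ≤ ∑ j ∈ T, X i j := Finset.sum_le_sum fun j hj => hμX i j hi hj
      _ ≤ ∑ j, X i j :=
        Finset.sum_le_sum_of_subset_of_nonneg (Finset.subset_univ _) fun j _ _ => hX i j
  have hv2 : rateConst κ B * Real.log (1 + d₁ / (S.card : ℝ) ^ 2) ≤
      (T.card * μ / √(d₂ : ℝ)) ^ 2 := by
    rw [div_pow, mul_pow, Real.sq_sqrt hd₂.le, le_div_iff₀ hd₂]
    rw [phi, mul_left_comm, div_mul_eq_mul_div, div_le_iff₀ (by positivity)] at h
    linarith
  rcases le_or_gt (32 * κ) S.card with hle | hlt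
  · refine scanRegion_compl_le_of_rows (C := rateConst κ B) (v := T.card * μ / √(d₂ : ℝ)) hκ hB hκB
      (by rw [rateConst]; nlinarith) (by rw [rateConst]; nlinarith) (T := Finset.univ)
      (A := S) ⟨j₀, Finset.mem_univ _⟩ (fun i => Finset.sum_nonneg fun j _ => hX i j)
      (by positivity) (fun i hi => ?_) ?_ ?_
    · rw [Finset.card_univ, Fintype.card_fin]
      gcongr
      exact hrow i hi
    · simpa [scanCost_self] using hle
    · simpa [scanCost_self] using hv2
  · refine (measureReal_mono (Set.compl_subset_compl.2 Set.subset_union_left)).trans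
      (sumRegion_compl_le (S := {i₀}) (T := Finset.univ) (M := T.card * μ / √(d₂ : ℝ)) hκ
        (by simp) ⟨j₀, Finset.mem_univ _⟩ (by positivity) ?_ (le_trans ?_ hv2))
    · simp only [Finset.sum_singleton, Finset.card_singleton, Finset.card_univ, Fintype.card_fin,
        Nat.cast_one, one_mul]
      gcongr
      exact hrow i₀ hi₀
    · rw [Finset.card_singleton, Finset.card_univ, Fintype.card_fin, scanCost_self, scanCost,
        Nat.choose_one_right, Real.log_mul (Real.exp_pos 1).ne' (by positivity), Real.log_exp]
      have h1 : Real.log (1 + d₁) / (32 * κ) ^ 2 ≤ Real.log (1 + d₁ / (S.card : ℝ) ^ 2) := by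
        refine (log_one_add_div_le (by nlinarith) (by positivity)).trans
          (Real.log_le_log (by positivity) ?_)
        gcongr
      have h2 : Real.log d₁ ≤ Real.log (1 + d₁) := Real.log_le_log (by linarith) (by linarith)
      have h3 : Real.log 2 ≤ Real.log (1 + d₁) := Real.log_le_log (by norm_num) (by linarith)
      have h4 := Real.log_two_gt_d9
      calc 8 * κ * (1 + Real.log d₁ + 1) ≤ 8 * κ * (4 * Real.log (1 + d₁)) := by
            gcongr
            linarith
        _ = 32768 * κ ^ 3 * (Real.log (1 + d₁) / (32 * κ) ^ 2) := by
            field_simp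
            ring
        _ ≤ rateConst κ B * Real.log (1 + d₁ / (S.card : ℝ) ^ 2) := by
            refine mul_le_mul ?_ h1 (div_nonneg (by linarith) (by positivity)) ?_
            · rw [rateConst]
              nlinarith
            · rw [rateConst]
              nlinarith

lemma scanRegion_compl_le_of_psi (hκ : 1 ≤ κ) (hB : 4 ≤ B) (hκB : 256 * κ ≤ Real.exp (B - 4))
    (hT : T.Nonempty) (hX : ∀ i j, 0 ≤ X i j) (hμ : 0 ≤ μ)
    (hμX : ∀ i j, i ∈ S → j ∈ T → μ ≤ X i j)
    (hST : 32 * κ * scanCost d₂ T.card ≤ S.card)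
    (h : rateConst κ B * psi T.card S.card d₂ d₁ ≤ μ ^ 2) :
    (Pmeas d₁ d₂ X).real (scanRegion κ B d₁ d₂)ᶜ ≤ Real.exp (-κ) := by
  have hT0 : (0 : ℝ) < T.card := by exact_mod_cast hT.card_pos
  have hκ3 : κ ≤ κ ^ 3 := le_self_pow₀ hκ (by norm_num)
  refine scanRegion_compl_le_of_rows (C := rateConst κ B) (v := √(T.card : ℝ) * μ) hκ hB hκB
    (by rw [rateConst]; nlinarith) (by rw [rateConst]; nlinarith) (T := T) (A := S) hT
    (fun i => Finset.sum_nonneg fun j _ => hX i j) (by positivity) (fun i hi => ?_) hST ?_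
  · rw [le_div_iff₀ (by positivity), mul_right_comm, Real.mul_self_sqrt hT0.le]
    calc T.card * μ = ∑ j ∈ T, μ := by simp
      _ ≤ ∑ j ∈ T, X i j := Finset.sum_le_sum fun j hj => hμX i j hi hj
  · rw [mul_pow, Real.sq_sqrt hT0.le]
    rw [psi, mul_left_comm, one_div, inv_mul_le_iff₀ hT0] at h
    rw [mul_div_right_comm]
    exact h

lemma scanCost_mul_le_of_psi {s₁ s₂ : ℕ} (hκ : 1 ≤ κ) (hB : 0 ≤ B) (hs₁ : 0 < s₁) (hs₂ : 0 < s₂)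
    (hd₂ : s₂ ≤ d₂) (hlt : (s₂ : ℝ) < 32 * κ * scanCost d₁ s₁)
    (h : rateConst κ B * psi s₁ s₂ d₁ d₂ ≤ μ ^ 2) :
    16 * κ * scanCost d₂ s₂ ≤ s₁ * s₂ * μ ^ 2 := by
  have hs1 : (0 : ℝ) < s₁ := by exact_mod_cast hs₁
  have hs2 : (0 : ℝ) < s₂ := by exact_mod_cast hs₂
  rw [psi, mul_left_comm, one_div, inv_mul_le_iff₀ hs1] at h
  have h1 : Real.log (1 + d₂ / s₂) / (32 * κ) ≤
      Real.log (1 + d₂ / (s₂ : ℝ) ^ 2 * scanCost d₁ s₁) := by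
    refine (log_one_add_div_le (by linarith) (by positivity)).trans
      (Real.log_le_log (by positivity) ?_)
    have : (s₂ : ℝ) / (32 * κ) ≤ scanCost d₁ s₁ := by
      rw [div_le_iff₀ (by positivity)]
      linarith
    calc 1 + (d₂ : ℝ) / s₂ / (32 * κ) = 1 + d₂ / (s₂ : ℝ) ^ 2 * (s₂ / (32 * κ)) := by field_simp
      _ ≤ 1 + d₂ / (s₂ : ℝ) ^ 2 * scanCost d₁ s₁ := by gcongr
  have hlog : 0 ≤ Real.log (1 + (d₂ : ℝ) / s₂) := Real.log_nonneg (by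
    have : 0 ≤ (d₂ : ℝ) / s₂ := by positivity
    linarith)
  have hκ2 : κ ^ 2 ≤ κ ^ 3 := pow_le_pow_right₀ hκ (by norm_num)
  have h2 : 2048 * κ ^ 2 ≤ rateConst κ B := by
    rw [rateConst]
    nlinarith
  calc 16 * κ * scanCost d₂ s₂ ≤ 16 * κ * (4 * (s₂ * Real.log (1 + d₂ / s₂))) := by
        gcongr
        exact scanCost_le hs₂ hd₂
    _ = s₂ * (2048 * κ ^ 2 * (Real.log (1 + d₂ / s₂) / (32 * κ))) := by
        field_simp
        ring
    _ ≤ s₂ * (rateConst κ B * Real.log (1 + d₂ / (s₂ : ℝ) ^ 2 * scanCost d₁ s₁)) :=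
        mul_le_mul_of_nonneg_left (mul_le_mul h2 h1 (by positivity)
          ((by positivity : (0 : ℝ) ≤ 2048 * κ ^ 2).trans h2)) hs2.le
    _ ≤ s₂ * (s₁ * μ ^ 2) := by
        refine mul_le_mul_of_nonneg_left ?_ hs2.le
        exact h
    _ = s₁ * s₂ * μ ^ 2 := by ring

lemma scanRegion_compl_le_of_psi_of_psi (hκ : 1 ≤ κ) (hB : 0 ≤ B)
    (hS : S.Nonempty) (hT : T.Nonempty) (hμ : 0 ≤ μ)
    (hμX : ∀ i j, i ∈ S → j ∈ T → μ ≤ X i j)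
    (hST : (S.card : ℝ) < 32 * κ * scanCost d₂ T.card)
    (hTS : (T.card : ℝ) < 32 * κ * scanCost d₁ S.card)
    (h₁ : rateConst κ B * psi S.card T.card d₁ d₂ ≤ μ ^ 2)
    (h₂ : rateConst κ B * psi T.card S.card d₂ d₁ ≤ μ ^ 2) :
    (Pmeas d₁ d₂ X).real (scanRegion κ B d₁ d₂)ᶜ ≤ Real.exp (-κ) := by
  have hSd : S.card ≤ d₁ := by simpa using S.card_le_univ
  have hTd : T.card ≤ d₂ := by simpa using T.card_le_univ
  have hT0 : (0 : ℝ) < T.card := by exact_mod_cast hT.card_pos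
  have hS0 : (0 : ℝ) < S.card := by exact_mod_cast hS.card_pos
  have e₁ := scanCost_mul_le_of_psi hκ hB hS.card_pos hT.card_pos hTd hTS h₁
  have e₂ := scanCost_mul_le_of_psi hκ hB hT.card_pos hS.card_pos hSd hST h₂
  refine (measureReal_mono (Set.compl_subset_compl.2 Set.subset_union_left)).trans
    (sumRegion_compl_le (M := √((S.card : ℝ) * T.card) * μ) hκ hS hT (by positivity) ?_ ?_)
  · rw [le_div_iff₀ (by positivity), mul_right_comm, Real.mul_self_sqrt (by positivity)]
    calc (S.card : ℝ) * T.card * μ = ∑ i ∈ S, ∑ j ∈ T, μ := by simp [mul_assoc]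
      _ ≤ ∑ i ∈ S, ∑ j ∈ T, X i j :=
        Finset.sum_le_sum fun i hi => Finset.sum_le_sum fun j hj => hμX i j hi hj
  · rw [mul_pow, Real.sq_sqrt (by positivity)]
    linarith

/-- The transposition-symmetric rejection region of the adaptive test. -/
def adaptiveRegion (κ B : ℝ) (d₁ d₂ : ℕ) : Set (Fin d₁ → Fin d₂ → ℝ) :=
  scanRegion κ B d₁ d₂ ∪ (fun y j i => y i j) ⁻¹' scanRegion κ B d₂ d₁

lemma measurable_transpose :
    Measurable (fun (y : Fin d₁ → Fin d₂ → ℝ) (j : Fin d₂) (i : Fin d₁) => y i j) := by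
  fun_prop

lemma measurableSet_adaptiveRegion (κ B : ℝ) (d₁ d₂ : ℕ) :
    MeasurableSet (adaptiveRegion κ B d₁ d₂) :=
  (measurableSet_scanRegion _ _ _ _).union
    (measurable_transpose (measurableSet_scanRegion _ _ _ _))

lemma Pmeas_real_preimage_transpose {s : Set (Fin d₂ → Fin d₁ → ℝ)} (hs : MeasurableSet s) :
    (Pmeas d₁ d₂ X).real ((fun y j i => y i j) ⁻¹' s) =
      (Pmeas d₂ d₁ fun j i => X i j).real s := by
  rw [← map_transpose_Pmeas (X := X), map_measureReal_apply measurable_transpose hs]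

lemma adaptiveRegion_null_le (hκ : 2 ≤ κ) (hB : 4 ≤ B) (hκB : 256 * κ ≤ Real.exp (B - 4)) :
    (Pmeas d₁ d₂ 0).real (adaptiveRegion κ B d₁ d₂) ≤ 6 * Real.exp (-(κ - 2)) := by
  refine (measureReal_union_le _ _).trans ?_
  rw [Pmeas_real_preimage_transpose (measurableSet_scanRegion _ _ _ _)]
  have h₁ := scanRegion_null_le hκ hB hκB d₁ d₂
  have h₂ := scanRegion_null_le hκ hB hκB d₂ d₁
  change _ + (Pmeas d₂ d₁ 0).real _ ≤ _
  linarith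

lemma adaptiveRegion_compl_le_of_scanRegion {ε : ℝ}
    (h : (Pmeas d₁ d₂ X).real (scanRegion κ B d₁ d₂)ᶜ ≤ ε) :
    (Pmeas d₁ d₂ X).real (adaptiveRegion κ B d₁ d₂)ᶜ ≤ ε :=
  (measureReal_mono (Set.compl_subset_compl.2 Set.subset_union_left)).trans h

lemma adaptiveRegion_compl_le_of_scanRegion_transpose {ε : ℝ}
    (h : (Pmeas d₂ d₁ fun j i => X i j).real (scanRegion κ B d₂ d₁)ᶜ ≤ ε) :
    (Pmeas d₁ d₂ X).real (adaptiveRegion κ B d₁ d₂)ᶜ ≤ ε := by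
  rw [← Pmeas_real_preimage_transpose (measurableSet_scanRegion _ _ _ _).compl] at h
  exact (measureReal_mono (Set.compl_subset_compl.2 Set.subset_union_right)).trans h

lemma adaptiveRegion_compl_le {s₁ s₂ : ℕ} (hκ : 1 ≤ κ) (hB : 4 ≤ B)
    (hκB : 256 * κ ≤ Real.exp (B - 4)) (hs₁ : 0 < s₁) (hs₂ : 0 < s₂) (hμ : 0 ≤ μ)
    (h : rateConst κ B * rateR s₁ s₂ d₁ d₂ ≤ μ ^ 2) (hXΘ : X ∈ Theta d₁ d₂ s₁ s₂ μ) :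
    (Pmeas d₁ d₂ X).real (adaptiveRegion κ B d₁ d₂)ᶜ ≤ Real.exp (-κ) := by
  obtain ⟨S, T, rfl, rfl, hμX, hX0⟩ := hXΘ
  have hS := Finset.card_pos.1 hs₁
  have hT := Finset.card_pos.1 hs₂
  have hSd : S.card ≤ d₁ := by simpa using S.card_le_univ
  have hTd : T.card ≤ d₂ := by simpa using T.card_le_univ
  have hX : ∀ i j, 0 ≤ X i j := fun i j => by
    by_cases hij : i ∈ S ∧ j ∈ T
    · exact hμ.trans (hμX i j hij.1 hij.2)
    · exact (hX0 i j hij).ge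
  have hC : 0 ≤ rateConst κ B := by
    rw [rateConst]
    positivity
  have hφ : ∀ x, rateR S.card T.card d₁ d₂ = x → rateConst κ B * x ≤ μ ^ 2 := fun x hx => hx ▸ h
  rcases min_choice (psi S.card T.card d₁ d₂ + psi T.card S.card d₂ d₁)
    (min (phi S.card T.card d₁ d₂) (phi T.card S.card d₂ d₁)) with h1 | h1
  · have h2 := hφ _ h1
    rw [mul_add] at h2
    have p₁ := mul_nonneg hC (psi_nonneg (s₂ := T.card) (d₂ := d₂) hSd)
    have p₂ := mul_nonneg hC (psi_nonneg (s₂ := S.card) (d₂ := d₁) hTd)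
    rcases le_or_gt (32 * κ * scanCost d₂ T.card) S.card with hST | hST
    · exact adaptiveRegion_compl_le_of_scanRegion
        (scanRegion_compl_le_of_psi hκ hB hκB hT hX hμ hμX hST (by linarith))
    rcases le_or_gt (32 * κ * scanCost d₁ S.card) T.card with hTS | hTS
    · exact adaptiveRegion_compl_le_of_scanRegion_transpose
        (scanRegion_compl_le_of_psi hκ hB hκB hS (fun j i => hX i j) hμ
          (fun j i hj hi => hμX i j hi hj) hTS (by linarith))
    · exact adaptiveRegion_compl_le_of_scanRegion
        (scanRegion_compl_le_of_psi_of_psi hκ (by linarith) hS hT hμ hμX hST hTS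
          (by linarith) (by linarith))
  rcases min_choice (phi S.card T.card d₁ d₂) (phi T.card S.card d₂ d₁) with h2 | h2
  · exact adaptiveRegion_compl_le_of_scanRegion_transpose
      (scanRegion_compl_le_of_phi hκ hB hκB hT hS (fun j i => hX i j) hμ
        (fun j i hj hi => hμX i j hi hj) (hφ _ (h1.trans h2)))
  · exact adaptiveRegion_compl_le_of_scanRegion
      (scanRegion_compl_le_of_phi hκ hB hκB hS hT hX hμ hμX (hφ _ (h1.trans h2)))

end Rates

/-- Adaptive upper bound (Proposition 2): a single test, not depending on the
sparsity levels, achieves risk at most η whenever μ² ≥ C·R(s₁*,s₂*,d₁,d₂). -/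
theorem adaptive_upper_bound (η : ℝ) (hη0 : 0 < η) (hη1 : η < 1)
    (C'' : ℝ) (hC'' : 0 < C'') :
    ∃ C : ℝ, 0 < C ∧
      ∀ (d₁ d₂ : ℕ), 0 < d₁ → 0 < d₂ → 8 ≤ min d₁ d₂ →
        ∃ Δ : (Fin d₁ → Fin d₂ → ℝ) → Bool, Measurable Δ ∧
          ∀ (s₁ s₂ : ℕ), 3 ≤ s₁ → s₁ ≤ d₁ → 3 ≤ s₂ → s₂ ≤ d₂ →
            C'' * Real.log (Real.log (d₁ : ℝ)) ≤
              (s₁ : ℝ) + Real.log (Real.log (d₂ : ℝ)) →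
            C'' * Real.log (Real.log (d₂ : ℝ)) ≤
              (s₂ : ℝ) + Real.log (Real.log (d₁ : ℝ)) →
            ∀ μ : ℝ, 0 < μ → C * rateR s₁ s₂ d₁ d₂ ≤ μ ^ 2 →
              risk d₁ d₂ s₁ s₂ μ Δ ≤ η := by
  classical
  set κ : ℝ := 2 + Real.log (12 / η) with hκdef
  have hη12 : (1 : ℝ) ≤ 12 / η := by
    rw [le_div_iff₀ hη0]
    linarith
  have hκ : 2 ≤ κ := by
    have := Real.log_nonneg hη12
    linarith
  set B : ℝ := 4 + Real.log (256 * κ) with hBdef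
  have hB : 4 ≤ B := by
    have := Real.log_nonneg (show 1 ≤ 256 * κ by linarith)
    linarith
  have hκB : 256 * κ ≤ Real.exp (B - 4) := by
    rw [hBdef, add_sub_cancel_left, Real.exp_log (by linarith)]
  have hexp : Real.exp (-(κ - 2)) = η / 12 := by
    rw [hκdef, add_sub_cancel_left, Real.exp_neg, Real.exp_log (by positivity), inv_div]
  have hexp' : Real.exp (-κ) ≤ η / 12 := by
    rw [← hexp]
    exact Real.exp_le_exp.2 (by linarith)
  refine ⟨rateConst κ B, by rw [rateConst]; positivity, fun d₁ d₂ _ _ _ => ?_⟩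
  have hmeas := measurableSet_adaptiveRegion κ B d₁ d₂
  refine ⟨fun y => decide (y ∈ adaptiveRegion κ B d₁ d₂), ?_, ?_⟩
  · refine measurable_to_bool ?_
    convert hmeas using 1
    ext y
    simp
  intro s₁ s₂ hs₁ _ hs₂ _ _ _ μ hμ h
  have h0 : {y | decide (y ∈ adaptiveRegion κ B d₁ d₂) = true} = adaptiveRegion κ B d₁ d₂ := by
    ext y
    simp
  have h1 : {y | decide (y ∈ adaptiveRegion κ B d₁ d₂) = false} =
      (adaptiveRegion κ B d₁ d₂)ᶜ := by
    ext y
    simp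
  have hnull := adaptiveRegion_null_le (d₁ := d₁) (d₂ := d₂) hκ hB hκB
  have hpow : ⨆ X ∈ Theta d₁ d₂ s₁ s₂ μ,
      (Pmeas d₁ d₂ X (adaptiveRegion κ B d₁ d₂)ᶜ).toReal ≤ η / 12 :=
    Real.iSup_le (fun X => Real.iSup_le (fun hX =>
      (adaptiveRegion_compl_le (by linarith) hB hκB (by omega) (by omega) hμ.le h hX).trans hexp')
        (by positivity)) (by positivity)
  rw [risk, h0, h1]
  rw [Measure.real, hexp] at hnull
  linarith
end
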